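/- arXiv:1505.07788 — 10 statements merged into one kernel-verified Lean document; each statement's English description precedes it below -/
import Mathlib

section
/- Let N ≥ 2, let {c_n}_{n≥1} be a real sequence, let {d_{n+1}}_{n≥1} be a positive chain sequence, and let −1 < A < B < 1. Then for every n with 1 ≤ n ≤ N all zeros of W_n in [−1,1] belong to the open interval (A,B) if and only if: (a) A/√(1−A²) < c_1 < B/√(1−B²), and (b) both {𝔡_{n+1}(A)}_{n=1}^{N−1} and {𝔡_{n+1}(B)}_{n=1}^{N−1} are finite positive chain sequences. -/
noncomputable section

/-- The functions `W n`, where `W c d n x` is `W_n(x)`: `W_0 = 1`, `W_1(x) = x - c_1*sqrt(1-x^2)`,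
`W_{n+1}(x) = (x - c_{n+1}*sqrt(1-x^2)) W_n(x) - d_{n+1} W_{n-1}(x)`. -/
def W (c d : ℕ → ℝ) : ℕ → ℝ → ℝ
  | 0, _ => 1
  | 1, x => x - c 1 * Real.sqrt (1 - x ^ 2)
  | n + 2, x =>
      (x - c (n + 2) * Real.sqrt (1 - x ^ 2)) * W c d (n + 1) x - d (n + 2) * W c d n x

/-- `{d_{n+1}}_{n≥1}` is a positive chain sequence: there is a parameter sequence `g` with
`0 ≤ g_1 < 1`, `0 < g_n < 1` for `n ≥ 2`, and `d_{n+1} = (1 - g_n) g_{n+1}` for `n ≥ 1`. -/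
def IsPositiveChainSeq (d : ℕ → ℝ) : Prop :=
  ∃ g : ℕ → ℝ, (0 ≤ g 1 ∧ g 1 < 1) ∧ (∀ n, 2 ≤ n → 0 < g n ∧ g n < 1) ∧
    ∀ n, 1 ≤ n → d (n + 1) = (1 - g n) * g (n + 1)

/-- `{d_{n+1}}_{n=1}^{N-1}` is a finite positive chain sequence: there are `g_1, ..., g_N` with
`0 ≤ g_1 < 1`, `0 < g_n < 1` for `2 ≤ n ≤ N`, and `d_{n+1} = (1 - g_n) g_{n+1}` for `1 ≤ n ≤ N-1`. -/
def IsFinitePositiveChainSeq (N : ℕ) (d : ℕ → ℝ) : Prop :=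
  ∃ g : ℕ → ℝ, (0 ≤ g 1 ∧ g 1 < 1) ∧ (∀ n, 2 ≤ n → n ≤ N → 0 < g n ∧ g n < 1) ∧
    ∀ n, 1 ≤ n → n ≤ N - 1 → d (n + 1) = (1 - g n) * g (n + 1)

/-- `frakd c d n x` is `𝔡_{n+1}(x) = d_{n+1} / ((x - c_n √(1-x²))(x - c_{n+1} √(1-x²)))`. -/
def frakd (c d : ℕ → ℝ) (n : ℕ) (x : ℝ) : ℝ :=
  d (n + 1) / ((x - c n * Real.sqrt (1 - x ^ 2)) * (x - c (n + 1) * Real.sqrt (1 - x ^ 2)))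

lemma W_add_two (c d : ℕ → ℝ) (n : ℕ) (x : ℝ) :
    W c d (n + 2) x =
      (x - c (n + 2) * Real.sqrt (1 - x ^ 2)) * W c d (n + 1) x - d (n + 2) * W c d n x := rfl

lemma W_neg_neg (c d : ℕ → ℝ) (n : ℕ) (x : ℝ) :
    W (-c) d n (-x) = (-1) ^ n * W c d n x := by
  induction n using Nat.twoStepInduction with
  | zero => simp [W]
  | one => simp [W]; ring
  | more n ih1 ih2 =>
    rw [W_add_two, W_add_two, ih1, ih2, neg_sq, Pi.neg_apply]
    ring

lemma frakd_neg_neg (c d : ℕ → ℝ) (n : ℕ) (x : ℝ) :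
    frakd (-c) d n (-x) = frakd c d n x := by
  unfold frakd
  rw [neg_sq, Pi.neg_apply, Pi.neg_apply]
  congr 1
  ring

lemma continuous_W (c d : ℕ → ℝ) (n : ℕ) : Continuous (W c d n) := by
  induction n using Nat.twoStepInduction with
  | zero => exact continuous_const
  | one =>
    change Continuous fun x : ℝ => x - c 1 * Real.sqrt (1 - x ^ 2)
    fun_prop
  | more n ih1 ih2 =>
    change Continuous fun x : ℝ =>
      (x - c (n + 2) * Real.sqrt (1 - x ^ 2)) * W c d (n + 1) x - d (n + 2) * W c d n x
    fun_prop

lemma IsPositiveChainSeq.pos {d : ℕ → ℝ} (hd : IsPositiveChainSeq d) {n : ℕ} (hn : 2 ≤ n) :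
    0 < d n := by
  obtain ⟨g, h1, hg, hgd⟩ := hd
  obtain ⟨m, rfl⟩ : ∃ m, n = m + 1 := ⟨n - 1, by omega⟩
  rw [hgd m (by omega)]
  refine mul_pos ?_ (hg _ hn).1
  rcases (show m = 1 ∨ 2 ≤ m by omega) with rfl | h
  · linarith
  · linarith [(hg m h).2]

/-- If `𝔡_{n+1}(x)` is a finite positive chain sequence and `x - c_1 √(1-x²) > 0`, then
`W_n(x) > 0`. -/
lemma W_pos_of_isFinitePositiveChainSeq {c d : ℕ → ℝ} {N : ℕ} {x : ℝ}
    (hd : ∀ n, 2 ≤ n → 0 < d n) (h1 : 0 < x - c 1 * Real.sqrt (1 - x ^ 2))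
    (h : IsFinitePositiveChainSeq N (fun k => frakd c d (k - 1) x)) {n : ℕ} (hn : n ≤ N) :
    0 < W c d n x := by
  obtain ⟨g, hg1, hg, hgd⟩ := h
  have hlt : ∀ n, n < N → g (n + 1) < 1 := by
    intro n hn
    rcases n with _ | n
    · exact hg1.2
    · exact (hg _ (by omega) (by omega)).2
  have key : ∀ n, n < N → 0 < W c d n x ∧
      0 < x - c (n + 1) * Real.sqrt (1 - x ^ 2) ∧
      (1 - g (n + 1)) * ((x - c (n + 1) * Real.sqrt (1 - x ^ 2)) * W c d n x)
        ≤ W c d (n + 1) x := by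
    intro n
    induction n with
    | zero =>
      intro _
      refine ⟨one_pos, h1, ?_⟩
      simp only [W, zero_add, mul_one]
      nlinarith [hg1.1]
    | succ n ih =>
      intro hn
      obtain ⟨hW, ha, hle⟩ := ih (by omega)
      have hgn := hlt n (by omega)
      have hgn' := hg (n + 2) (by omega) (by omega)
      have hW' : 0 < W c d (n + 1) x :=
        lt_of_lt_of_le (mul_pos (by linarith) (mul_pos ha hW)) hle
      have hD := hd (n + 2) (by omega)
      have e := hgd (n + 1) (by omega) (by omega)
      simp only [frakd, Nat.add_sub_cancel] at e
      rw [show n + 1 + 1 = n + 2 from rfl] at e ⊢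
      have hprod : 0 < (x - c (n + 1) * Real.sqrt (1 - x ^ 2)) *
          (x - c (n + 2) * Real.sqrt (1 - x ^ 2)) := by
        have hq : 0 < (1 - g (n + 1)) * g (n + 2) := mul_pos (by linarith) hgn'.1
        rw [← e] at hq
        exact (div_pos_iff_of_pos_left hD).1 hq
      have ha' := pos_of_mul_pos_right hprod ha.le
      rw [div_eq_iff hprod.ne'] at e
      refine ⟨hW', ha', ?_⟩
      rw [W_add_two, e]
      have := mul_le_mul_of_nonneg_left hle (mul_pos hgn'.1 ha').le
      linarith
  rcases n with _ | n
  · exact one_pos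
  · obtain ⟨hW, ha, hle⟩ := key n hn
    exact lt_of_lt_of_le (mul_pos (by linarith [hlt n hn]) (mul_pos ha hW)) hle

lemma isFinitePositiveChainSeq_of_W_pos {c d : ℕ → ℝ} {N : ℕ} {x : ℝ}
    (hN : 1 ≤ N) (hd : ∀ n, 2 ≤ n → 0 < d n) (h : ∀ n, n ≤ N → 0 < W c d n x) :
    IsFinitePositiveChainSeq N (fun k => frakd c d (k - 1) x) := by
  have ha : ∀ n, n < N → 0 < x - c (n + 1) * Real.sqrt (1 - x ^ 2) := by
    intro n hn
    rcases n with _ | n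
    · exact h 1 hn
    · have h0 := h n (by omega)
      have h1 := h (n + 1) (by omega)
      have h2 := h (n + 2) (by omega)
      rw [W_add_two] at h2
      have := mul_pos (hd (n + 2) (by omega)) h0
      exact pos_of_mul_pos_left (by linarith) h1.le
  refine ⟨fun n => 1 - W c d n x /
    ((x - c n * Real.sqrt (1 - x ^ 2)) * W c d (n - 1) x), ?_, ?_, ?_⟩
  · simp [W, div_self (ha 0 hN).ne']
  · intro n hn hnN
    obtain ⟨m, rfl⟩ : ∃ m, n = m + 2 := ⟨n - 2, by omega⟩
    have h0 := h m (by omega)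
    have h1 := h (m + 1) (by omega)
    have h2 := h (m + 2) (by omega)
    have hp := mul_pos (ha (m + 1) (by omega)) h1
    have hD := mul_pos (hd (m + 2) (by omega)) h0
    rw [show m + 1 + 1 = m + 2 from rfl] at hp
    simp only [Nat.add_succ_sub_one]
    constructor
    · rw [sub_pos, div_lt_one hp, W_add_two]
      linarith
    · have := div_pos h2 hp
      linarith
  · intro n hn hnN
    obtain ⟨m, rfl⟩ : ∃ m, n = m + 1 := ⟨n - 1, by omega⟩
    have h0 := (h m (by omega)).ne'
    have h1 := (h (m + 1) (by omega)).ne'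
    have ha1 := (ha m (by omega)).ne'
    have ha2 := (ha (m + 1) (by omega)).ne'
    simp only [frakd, Nat.add_sub_cancel]
    rw [show m + 1 + 1 = m + 2 from rfl] at ha2 ⊢
    rw [W_add_two]
    generalize x - c (m + 1) * Real.sqrt (1 - x ^ 2) = a at *
    generalize x - c (m + 2) * Real.sqrt (1 - x ^ 2) = b at *
    field_simp
    ring

lemma inv_le_of_one_le_add_sq {l h R k S : ℝ} (hl : 0 ≤ l) (hh : 0 ≤ h) (hlh : 1 ≤ (l + h) ^ 2)
    (hR : 0 < R) (hk : 0 < k) (hS : l * R + k * h ≤ S) :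
    0 < S ∧ 1 / S ≤ l / R + h / k := by
  have hpos : 0 < l * R + k * h := by
    rcases hl.eq_or_lt with rfl | hl'
    · have : 0 < h := by
        rcases hh.eq_or_lt with rfl | hh'
        · norm_num at hlh
        · exact hh'
      positivity
    · positivity
  refine ⟨hpos.trans_le hS, (one_div_le_one_div_of_le hpos hS).trans ?_⟩
  rw [div_add_div _ _ hR.ne' hk.ne', div_le_div_iff₀ hpos (mul_pos hR hk)]
  nlinarith [mul_nonneg (mul_nonneg hl hh) (sq_nonneg (R - k)),
    mul_le_mul_of_nonneg_right hlh (mul_pos hR hk).le]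

/-- Positivity of `W_n` at a point propagates to the right. -/
lemma W_pos_of_le {c d : ℕ → ℝ} (hd : IsPositiveChainSeq d) {N : ℕ} {B x : ℝ}
    (hB : -1 < B) (hB1 : B < 1) (hBx : B ≤ x) (hx : x ≤ 1)
    (h : ∀ n, n ≤ N → 0 < W c d n B) {n : ℕ} (hn : n ≤ N) : 0 < W c d n x := by
  have hdpos := fun n => hd.pos (n := n)
  obtain ⟨g, hg1, hg, hgd⟩ := hd
  have hk : ∀ n, 0 < 1 - g (n + 1) := by
    intro n
    rcases n with _ | n
    · linarith [hg1.2]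
    · linarith [(hg (n + 2) (by omega)).2]
  have hsB : 0 < Real.sqrt (1 - B ^ 2) := Real.sqrt_pos.2 (by nlinarith)
  obtain ⟨l, hl⟩ : ∃ l, Real.sqrt (1 - x ^ 2) = l * Real.sqrt (1 - B ^ 2) :=
    ⟨_, (div_mul_cancel₀ _ hsB.ne').symm⟩
  have hl0 : 0 ≤ l := nonneg_of_mul_nonneg_left (hl ▸ Real.sqrt_nonneg _) hsB
  have hsq : 1 - x ^ 2 = l ^ 2 * (1 - B ^ 2) := by
    rw [← Real.sq_sqrt (show 0 ≤ 1 - x ^ 2 by nlinarith), hl, mul_pow,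
      Real.sq_sqrt (by nlinarith)]
  obtain ⟨t, ht⟩ : ∃ t, x = l * B + t := ⟨x - l * B, by ring⟩
  have ht0 : 0 ≤ t := by
    have hB2 : 0 < 1 - B ^ 2 := Real.sqrt_pos.1 hsB
    rcases le_or_gt 0 B with hB0 | hB0
    · have : l ≤ 1 := by
        by_contra! hl1
        nlinarith [mul_lt_mul_of_pos_right (show 1 < l ^ 2 by nlinarith) hB2]
      nlinarith
    · rcases le_or_gt 0 x with hx0 | hx0
      · nlinarith
      · have : 1 ≤ l := by
          by_contra! hl1
          nlinarith [mul_lt_mul_of_pos_right (show l ^ 2 < 1 by nlinarith) hB2]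
        nlinarith
  have hlt : 1 ≤ (l + t) ^ 2 := by
    rw [ht] at hsq
    nlinarith [mul_nonneg (mul_nonneg hl0 ht0) (sub_nonneg.2 hB1.le)]
  have key : ∀ n, n < N → 0 < W c d n x ∧
      l * (W c d (n + 1) B / W c d n B) + (1 - g (n + 1)) * t ≤
        W c d (n + 1) x / W c d n x := by
    intro n
    induction n with
    | zero =>
      intro _
      refine ⟨one_pos, ?_⟩
      simp only [W, zero_add, div_one]
      rw [hl]
      nlinarith [mul_nonneg hg1.1 ht0]
    | succ n ih =>
      intro hn
      obtain ⟨hW, hle⟩ := ih (by omega)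
      have h0 := h n (by omega)
      have h1 := h (n + 1) (by omega)
      obtain ⟨hS, hinv⟩ := inv_le_of_one_le_add_sq hl0 ht0 hlt (div_pos h1 h0) (hk n) hle
      have hW' : 0 < W c d (n + 1) x := (div_pos_iff_of_pos_right hW).1 hS
      refine ⟨hW', ?_⟩
      have ratio : ∀ y, 0 < W c d (n + 1) y → W c d (n + 1 + 1) y / W c d (n + 1) y =
          (y - c (n + 2) * Real.sqrt (1 - y ^ 2)) -
            d (n + 2) * (W c d n y / W c d (n + 1) y) := by
        intro y hy
        rw [W_add_two]
        field_simp
      rw [ratio x hW', ratio B h1, hl]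
      have hD := mul_le_mul_of_nonneg_left hinv (hdpos (n + 2) (by omega)).le
      have hDk : d (n + 2) * (t / (1 - g (n + 1))) = g (n + 2) * t := by
        rw [hgd (n + 1) (by omega)]
        have := (hk n).ne'
        field_simp
      rw [one_div_div, mul_add, hDk, div_div_eq_mul_div, mul_div_assoc] at hD
      rw [show n + 1 + 1 = n + 2 from rfl]
      linarith
  rcases n with _ | n
  · exact one_pos
  · obtain ⟨hW, hle⟩ := key n hn
    exact (div_pos_iff_of_pos_right hW).1
      (inv_le_of_one_le_add_sq hl0 ht0 hlt (div_pos (h _ hn) (h _ (by omega))) (hk n) hle).1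

lemma W_one_pos {c d : ℕ → ℝ} (hd : IsPositiveChainSeq d) (n : ℕ) : 0 < W c d n 1 := by
  refine W_pos_of_isFinitePositiveChainSeq (N := n) (fun _ => hd.pos) (by simp) ?_ le_rfl
  obtain ⟨g, hg1, hg, hgd⟩ := hd
  refine ⟨g, hg1, fun m hm _ => hg m hm, fun m hm _ => ?_⟩
  simpa [frakd] using hgd m hm

/-- All zeros lie to the left of `B` if and only if `c_1 < B / √(1-B²)` and `𝔡_{n+1}(B)` is a
finite positive chain sequence. -/
lemma forall_zero_lt_iff {c d : ℕ → ℝ} (hd : IsPositiveChainSeq d) {N : ℕ} (hN : 1 ≤ N) {B : ℝ}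
    (hB : -1 < B) (hB1 : B < 1) :
    (∀ n, 1 ≤ n → n ≤ N → ∀ x ∈ Set.Icc (-1 : ℝ) 1, W c d n x = 0 → x < B) ↔
      (c 1 < B / Real.sqrt (1 - B ^ 2) ∧
        IsFinitePositiveChainSeq N (fun k => frakd c d (k - 1) B)) := by
  have hsB : 0 < Real.sqrt (1 - B ^ 2) := Real.sqrt_pos.2 (by nlinarith)
  rw [lt_div_iff₀ hsB]
  constructor
  · intro h
    have hpos : ∀ n, n ≤ N → 0 < W c d n B := by
      intro n hn
      rcases Nat.eq_zero_or_pos n with rfl | hn1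
      · exact one_pos
      by_contra! hneg
      obtain ⟨x, hx, hx0⟩ := intermediate_value_Icc hB1.le (continuous_W c d n).continuousOn
        ⟨hneg, (W_one_pos hd n).le⟩
      exact absurd (h n hn1 hn x ⟨by linarith [hx.1], hx.2⟩ hx0) (not_lt.2 hx.1)
    exact ⟨sub_pos.1 (hpos 1 hN), isFinitePositiveChainSeq_of_W_pos hN (fun _ => hd.pos) hpos⟩
  · rintro ⟨h1, h⟩ n - hn x hx hx0
    by_contra! hBx
    exact (W_pos_of_le hd hB hB1 hBx hx.2 (fun m hm =>
      W_pos_of_isFinitePositiveChainSeq (fun _ => hd.pos) (sub_pos.2 h1) h hm) hn).ne' hx0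

/-- The mirror image of `forall_zero_lt_iff` under `x ↦ -x`. -/
lemma forall_zero_gt_iff {c d : ℕ → ℝ} (hd : IsPositiveChainSeq d) {N : ℕ} (hN : 1 ≤ N) {A : ℝ}
    (hA : -1 < A) (hA1 : A < 1) :
    (∀ n, 1 ≤ n → n ≤ N → ∀ x ∈ Set.Icc (-1 : ℝ) 1, W c d n x = 0 → A < x) ↔
      (A / Real.sqrt (1 - A ^ 2) < c 1 ∧
        IsFinitePositiveChainSeq N (fun k => frakd c d (k - 1) A)) := by
  have key := forall_zero_lt_iff (c := -c) hd hN (B := -A) (by linarith) (by linarith)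
  simp only [frakd_neg_neg, neg_sq, Pi.neg_apply, neg_div, neg_lt_neg_iff] at key
  rw [← key]
  refine forall₃_congr fun n _ _ => ⟨fun h x hx hx0 => ?_, fun h x hx hx0 => ?_⟩
  · have e := W_neg_neg c d n (-x)
    rw [neg_neg, hx0, eq_comm, mul_eq_zero] at e
    have := h (-x) ⟨by linarith [hx.2], by linarith [hx.1]⟩ (e.resolve_left (by simp))
    linarith
  · have := h (-x) ⟨by linarith [hx.2], by linarith [hx.1]⟩ (by rw [W_neg_neg, hx0, mul_zero])
    linarith

theorem stmt0 (N : ℕ) (hN : 2 ≤ N) (c d : ℕ → ℝ)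
    (hd : IsPositiveChainSeq d)
    (A B : ℝ) (hA : -1 < A) (hAB : A < B) (hB : B < 1) :
    (∀ n, 1 ≤ n → n ≤ N → ∀ x ∈ Set.Icc (-1 : ℝ) 1, W c d n x = 0 → A < x ∧ x < B) ↔
      (A / Real.sqrt (1 - A ^ 2) < c 1 ∧ c 1 < B / Real.sqrt (1 - B ^ 2) ∧
        IsFinitePositiveChainSeq N (fun k => frakd c d (k - 1) A) ∧
        IsFinitePositiveChainSeq N (fun k => frakd c d (k - 1) B)) := by
  have hL := forall_zero_gt_iff (c := c) hd (N := N) (by omega) hA (hAB.trans hB)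
  have hR := forall_zero_lt_iff (c := c) hd (N := N) (by omega) (hA.trans hAB) hB
  constructor
  · intro h
    obtain ⟨h1, h2⟩ := hL.1 fun n hn hnN x hx hx0 => (h n hn hnN x hx hx0).1
    obtain ⟨h3, h4⟩ := hR.1 fun n hn hnN x hx hx0 => (h n hn hnN x hx hx0).2
    exact ⟨h1, h3, h2, h4⟩
  · rintro ⟨h1, h3, h2, h4⟩ n hn hnN x hx hx0
    exact ⟨hL.2 ⟨h1, h2⟩ n hn hnN x hx hx0, hR.2 ⟨h3, h4⟩ n hn hnN x hx hx0⟩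
end
end

section
/- Let a, b ∈ ℝ and 0 < q < 1, and define h(x;a,b) = (x − a√(1−x²))(x − b√(1−x²)) for x ∈ [−1,1]. Let u^{(−)} = u^{(−)}(a,b,q) and u^{(+)} = u^{(+)}(a,b,q). Then h(x;a,b) ≥ q for every x in [−1, u^{(−)}/√(1+(u^{(−)})²)] ∪ [u^{(+)}/√(1+(u^{(+)})²), 1]. -/
noncomputable section

/-- The smaller root `u⁻(a,b,q)` of `P(u) = (1-q)u² - (a+b)u + (ab - q)` (for `q < 1`). -/
def uMinus (a b q : ℝ) : ℝ :=
  ((a + b) - Real.sqrt ((a + b) ^ 2 - 4 * (1 - q) * (a * b - q))) / (2 * (1 - q))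

/-- The larger root `u⁺(a,b,q)` of `P(u) = (1-q)u² - (a+b)u + (ab - q)` (for `q < 1`). -/
def uPlus (a b q : ℝ) : ℝ :=
  ((a + b) + Real.sqrt ((a + b) ^ 2 - 4 * (1 - q) * (a * b - q))) / (2 * (1 - q))

theorem discrim_nonneg (a b : ℝ) {q : ℝ} (hq0 : 0 ≤ q) (hq1 : q ≤ 1) :
    0 ≤ (a + b) ^ 2 - 4 * (1 - q) * (a * b - q) := by
  have h : (a + b) ^ 2 - 4 * (1 - q) * (a * b - q)
      = (1 - q) * (a - b) ^ 2 + q * (a + b) ^ 2 + 4 * (q * (1 - q)) := by ring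
  have hq : 0 ≤ 1 - q := sub_nonneg.2 hq1
  rw [h]
  positivity

theorem uMinus_le_uPlus (a b : ℝ) {q : ℝ} (hq1 : q < 1) : uMinus a b q ≤ uPlus a b q := by
  have hq : 0 < 1 - q := sub_pos.2 hq1
  unfold uMinus uPlus
  gcongr
  linarith [Real.sqrt_nonneg ((a + b) ^ 2 - 4 * (1 - q) * (a * b - q))]

theorem homogeneous_factorization (a b x s : ℝ) {q : ℝ} (hq0 : 0 ≤ q) (hq1 : q < 1) :
    (x - a * s) * (x - b * s) - q * (x ^ 2 + s ^ 2)
      = (1 - q) * ((x - uMinus a b q * s) * (x - uPlus a b q * s)) := by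
  have hq : 1 - q ≠ 0 := (sub_pos.2 hq1).ne'
  have hd := Real.sq_sqrt (discrim_nonneg a b hq0 hq1.le)
  unfold uMinus uPlus
  set d := Real.sqrt ((a + b) ^ 2 - 4 * (1 - q) * (a * b - q))
  field_simp
  linear_combination s ^ 2 * hd

theorem le_mul_of_le_div_sqrt {x s u : ℝ} (hs : 0 < s) (hx : x ^ 2 + s ^ 2 = 1)
    (h : x ≤ u / Real.sqrt (1 + u ^ 2)) : x ≤ u * s := by
  have hr : 0 < Real.sqrt (1 + u ^ 2) := Real.sqrt_pos.2 (by positivity)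
  have hr2 : Real.sqrt (1 + u ^ 2) ^ 2 = 1 + u ^ 2 := Real.sq_sqrt (by positivity)
  rw [le_div_iff₀ hr] at h
  set r := Real.sqrt (1 + u ^ 2)
  have key : (x * r) ^ 2 - u ^ 2 = x ^ 2 - (u * s) ^ 2 := by
    rw [mul_pow, hr2]
    linear_combination (u ^ 2) * hx
  rcases le_or_gt x 0 with hx0 | hx0
  · rcases le_or_gt 0 u with hu | hu
    · exact hx0.trans (by positivity)
    · have h1 : u ^ 2 ≤ (x * r) ^ 2 := by nlinarith
      have h2 : (u * s) ^ 2 ≤ x ^ 2 := by linarith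
      have h3 := sq_le_sq.1 h2
      rw [abs_of_nonpos hx0, abs_of_neg (mul_neg_of_neg_of_pos hu hs)] at h3
      linarith
  · have hxr : 0 < x * r := by positivity
    have h1 : (x * r) ^ 2 ≤ u ^ 2 := by gcongr
    have h2 : x ^ 2 ≤ (u * s) ^ 2 := by linarith
    exact abs_le_of_sq_le_sq' h2 (mul_pos (hxr.trans_le h) hs).le |>.2

theorem mul_le_of_div_sqrt_le {x s u : ℝ} (hs : 0 < s) (hx : x ^ 2 + s ^ 2 = 1)
    (h : u / Real.sqrt (1 + u ^ 2) ≤ x) : u * s ≤ x := by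
  have := le_mul_of_le_div_sqrt (x := -x) (u := -u) hs (by rwa [neg_sq])
    (by rw [neg_sq, neg_div]; exact neg_le_neg h)
  linarith

theorem stmt2 (a b q : ℝ) (hq0 : 0 < q) (hq1 : q < 1) :
    ∀ x ∈ Set.Icc (-1 : ℝ) (uMinus a b q / Real.sqrt (1 + uMinus a b q ^ 2)) ∪
        Set.Icc (uPlus a b q / Real.sqrt (1 + uPlus a b q ^ 2)) 1,
      q ≤ (x - a * Real.sqrt (1 - x ^ 2)) * (x - b * Real.sqrt (1 - x ^ 2)) := by
  intro x hx
  by_cases hx1 : x ^ 2 < 1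
  · have hs : 0 < Real.sqrt (1 - x ^ 2) := Real.sqrt_pos.2 (by linarith)
    have hxs : x ^ 2 + Real.sqrt (1 - x ^ 2) ^ 2 = 1 := by
      rw [Real.sq_sqrt (by linarith)]
      ring
    have hf := homogeneous_factorization a b x (Real.sqrt (1 - x ^ 2)) hq0.le hq1
    rw [hxs, mul_one] at hf
    have hle := mul_le_mul_of_nonneg_right (uMinus_le_uPlus a b hq1) hs.le
    refine sub_nonneg.1 (hf ▸ mul_nonneg (sub_pos.2 hq1).le ?_)
    rcases hx with hx | hx
    · have h := le_mul_of_le_div_sqrt hs hxs hx.2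
      exact mul_nonneg_of_nonpos_of_nonpos (by linarith) (by linarith)
    · have h := mul_le_of_div_sqrt_le hs hxs hx.1
      exact mul_nonneg (by linarith) (by linarith)
  · rw [Real.sqrt_eq_zero_of_nonpos (by linarith)]
    nlinarith
end
end

section
/- Let N ≥ 2, let {c_n}_{n≥1} be real, let {d_{n+1}}_{n=1}^{N−1} be a finite positive chain sequence, and let {q_{n+1}}_{n=1}^{N−1} be a finite scaling sequence for {d_{n+1}}_{n=1}^{N−1} with q_{n+1} < 1 for 1 ≤ n ≤ N−1. For 1 ≤ n ≤ N−1 set u_{n+1}^{(±)} = u^{(±)}(c_n, c_{n+1}, q_{n+1}), and define A_N = min_{2≤n≤N} u_n^{(−)}/√(1+(u_n^{(−)})²) and B_N = max_{2≤n≤N} u_n^{(+)}/√(1+(u_n^{(+)})²). Then every zero of W_N in [−1,1] lies in the open interval (A_N, B_N). -/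
noncomputable section

/-- `{q_{n+1}}_{n=1}^{N-1}` is a finite scaling sequence for `{d_{n+1}}_{n=1}^{N-1}`:
it is positive, `q_{n+1} ≤ 1`, and `{d_{n+1}/q_{n+1}}_{n=1}^{N-1}` is a finite positive
chain sequence. -/
def IsFiniteScalingSeq (N : ℕ) (d q : ℕ → ℝ) : Prop :=
  (∀ n, 1 ≤ n → n ≤ N - 1 → 0 < q (n + 1) ∧ q (n + 1) ≤ 1) ∧
  IsFinitePositiveChainSeq N (fun k => d k / q k)

/-- The discriminant of `P` dominates the squared slope of `P` at `a`, since `P(a) < 0`. -/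
theorem abs_lt_sqrt_discrim {q : ℝ} (a b : ℝ) (hq : 0 < q) (hq1 : q < 1) :
    |2 * (1 - q) * a - (a + b)| < √((a + b) ^ 2 - 4 * (1 - q) * (a * b - q)) := by
  apply Real.lt_sqrt_of_sq_lt
  rw [sq_abs]
  have h : 0 < 4 * (1 - q) * q * (1 + a ^ 2) := by
    have := sub_pos.2 hq1
    positivity
  linarith

theorem two_mul_uPlus (a b : ℝ) {q : ℝ} (hq1 : q < 1) :
    2 * (1 - q) * uPlus a b q = a + b + √((a + b) ^ 2 - 4 * (1 - q) * (a * b - q)) := by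
  have := (sub_pos.2 hq1).ne'
  unfold uPlus
  field_simp

theorem uPlus_comm (a b q : ℝ) : uPlus a b q = uPlus b a q := by
  rw [uPlus, uPlus, add_comm a b, mul_comm a b]

theorem lt_uPlus {q : ℝ} (a b : ℝ) (hq : 0 < q) (hq1 : q < 1) : a < uPlus a b q := by
  have h1 := (abs_lt.1 (abs_lt_sqrt_discrim a b hq hq1)).2
  have h2 := two_mul_uPlus a b hq1
  have h3 : 0 < 2 * (1 - q) := by linarith
  exact lt_of_mul_lt_mul_left (by linarith) h3.le

theorem uPlus_isRoot {q : ℝ} (a b : ℝ) (hq : 0 < q) (hq1 : q < 1) :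
    (1 - q) * uPlus a b q ^ 2 - (a + b) * uPlus a b q + (a * b - q) = 0 := by
  have hD : 0 ≤ (a + b) ^ 2 - 4 * (1 - q) * (a * b - q) :=
    (Real.sqrt_pos.1 ((abs_nonneg _).trans_lt (abs_lt_sqrt_discrim a b hq hq1))).le
  have hsq := Real.sq_sqrt hD
  rw [← sub_eq_iff_eq_add'.2 (two_mul_uPlus a b hq1)] at hsq
  have h : 4 * (1 - q) *
      ((1 - q) * uPlus a b q ^ 2 - (a + b) * uPlus a b q + (a * b - q)) = 0 := by
    linear_combination hsq
  exact (mul_eq_zero.1 h).resolve_left (by linarith)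

theorem uMinus_eq_neg_uPlus (a b q : ℝ) : uMinus a b q = -uPlus (-a) (-b) q := by
  unfold uMinus uPlus
  rw [show (-a + -b) ^ 2 - 4 * (1 - q) * (-a * -b - q)
    = (a + b) ^ 2 - 4 * (1 - q) * (a * b - q) by ring]
  ring

theorem mul_sqrt_one_sub_sq_le {u x : ℝ} (hx : x ∈ Set.Icc (-1 : ℝ) 1)
    (h : u / √(1 + u ^ 2) ≤ x) : u * √(1 - x ^ 2) ≤ x := by
  have hs : √(1 - x ^ 2) ^ 2 = 1 - x ^ 2 := Real.sq_sqrt (by nlinarith [hx.1, hx.2])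
  have hv : √(1 + u ^ 2) ^ 2 = 1 + u ^ 2 := Real.sq_sqrt (by positivity)
  have hv0 : 0 < √(1 + u ^ 2) := Real.sqrt_pos.2 (by positivity)
  have hs0 := Real.sqrt_nonneg (1 - x ^ 2)
  rw [div_le_iff₀ hv0] at h
  rcases lt_or_ge 0 u with hu | hu
  · have hx0 : 0 < x := pos_of_mul_pos_left (hu.trans_le h) hv0.le
    have := pow_le_pow_left₀ hu.le h 2
    refine (le_abs_self _).trans (abs_le_of_sq_le_sq ?_ hx0.le)
    rw [mul_pow] at this ⊢
    rw [hv] at this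
    rw [hs]
    linarith
  · rcases le_or_gt 0 x with hx0 | hx0
    · exact (mul_nonpos_of_nonpos_of_nonneg hu hs0).trans hx0
    · have := pow_le_pow_left₀ (by nlinarith) (neg_le_neg h) 2
      have h2 : -x ≤ -(u * √(1 - x ^ 2)) := by
        refine (le_abs_self _).trans (abs_le_of_sq_le_sq ?_ (by nlinarith))
        rw [neg_sq, neg_sq, mul_pow] at this ⊢
        rw [hv] at this
        rw [hs]
        linarith
      linarith

theorem neg_one_lt_div_sqrt_one_add_sq (u : ℝ) : -1 < u / √(1 + u ^ 2) := by
  rw [lt_div_iff₀ (Real.sqrt_pos.2 (by positivity))]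
  have : |u| < √(1 + u ^ 2) := Real.lt_sqrt_of_sq_lt (by rw [sq_abs]; linarith)
  linarith [(abs_lt.1 this).1]

theorem sub_mul_sqrt_pos_of_uPlus_le {a b q x : ℝ} (hq : 0 < q) (hq1 : q < 1)
    (hx : x ∈ Set.Icc (-1 : ℝ) 1) (h : uPlus a b q / √(1 + uPlus a b q ^ 2) ≤ x) :
    0 < x - a * √(1 - x ^ 2) := by
  have h1 := mul_sqrt_one_sub_sq_le hx h
  have h2 := lt_uPlus a b hq hq1
  have h3 := (neg_one_lt_div_sqrt_one_add_sq _).trans_le h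
  have hs : √(1 - x ^ 2) ^ 2 = 1 - x ^ 2 := Real.sq_sqrt (by nlinarith [hx.1, hx.2])
  rcases (Real.sqrt_nonneg (1 - x ^ 2)).eq_or_lt with h0 | h0
  · rw [← h0] at hs ⊢
    nlinarith
  · nlinarith

theorem le_mul_of_uPlus_le {a b q x : ℝ} (hq : 0 < q) (hq1 : q < 1)
    (hx : x ∈ Set.Icc (-1 : ℝ) 1) (h : uPlus a b q / √(1 + uPlus a b q ^ 2) ≤ x) :
    q ≤ (x - a * √(1 - x ^ 2)) * (x - b * √(1 - x ^ 2)) := by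
  have h1 := mul_sqrt_one_sub_sq_le hx h
  have hs : √(1 - x ^ 2) ^ 2 = 1 - x ^ 2 := Real.sq_sqrt (by nlinarith [hx.1, hx.2])
  have hs0 := Real.sqrt_nonneg (1 - x ^ 2)
  have hr := uPlus_isRoot a b hq hq1
  have hslope : 0 ≤ 2 * (1 - q) * uPlus a b q - (a + b) := by
    rw [two_mul_uPlus a b hq1, add_sub_cancel_left]
    exact Real.sqrt_nonneg _
  set u := uPlus a b q
  set s := √(1 - x ^ 2)
  have h2 : 0 ≤ (1 - q) * (x - u * s) ^ 2 :=
    mul_nonneg (by linarith) (sq_nonneg _)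
  have h3 : 0 ≤ (x - u * s) * s * (2 * (1 - q) * u - (a + b)) :=
    mul_nonneg (mul_nonneg (by linarith) hs0) hslope
  have key : (x - a * s) * (x - b * s) - q =
      (1 - q) * (x - u * s) ^ 2 + (x - u * s) * s * (2 * (1 - q) * u - (a + b)) := by
    linear_combination s ^ 2 * hr + q * hs
  linarith

/-- If consecutive factors are positive and their products dominate `q`, then `W` is positive. -/
theorem W_pos_of_scaling {N : ℕ} {c d q : ℕ → ℝ} {x : ℝ} (hN : 1 ≤ N)
    (hq : IsFiniteScalingSeq N d q)
    (hy : ∀ n, 1 ≤ n → n ≤ N → 0 < x - c n * √(1 - x ^ 2))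
    (hyy : ∀ n, 1 ≤ n → n + 1 ≤ N →
      q (n + 1) ≤ (x - c n * √(1 - x ^ 2)) * (x - c (n + 1) * √(1 - x ^ 2))) :
    0 < W c d N x := by
  obtain ⟨hq0, g, ⟨hg0, hg1⟩, hg, hdg⟩ := hq
  have hglt : ∀ n, 1 ≤ n → n ≤ N → 0 < 1 - g n := fun n h1 h2 => by
    rcases h1.eq_or_lt with rfl | h
    · linarith
    · linarith [(hg n h h2).2]
  have key : ∀ n, n + 1 ≤ N → 0 < W c d n x ∧
      (1 - g (n + 1)) * (x - c (n + 1) * √(1 - x ^ 2)) * W c d n x ≤ W c d (n + 1) x := by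
    intro n
    induction n with
    | zero =>
      intro h
      have := hy 1 le_rfl h
      simp only [W, zero_add]
      exact ⟨one_pos, by nlinarith⟩
    | succ n ih =>
      intro h
      obtain ⟨hw0, hw⟩ := ih (by omega)
      have hy1 := hy (n + 1) (by omega) (by omega)
      have hy2 := hy (n + 2) (by omega) h
      have hg1 := hglt (n + 1) (by omega) (by omega)
      have hg2 := (hg (n + 2) (by omega) h).1
      have hw1 := (mul_pos (mul_pos hg1 hy1) hw0).trans_le hw
      refine ⟨hw1, ?_⟩
      have hd := hdg (n + 1) (by omega) (by omega)
      rw [div_eq_iff (hq0 (n + 1) (by omega) (by omega)).1.ne'] at hd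
      have hle := hyy (n + 1) (by omega) h
      rw [show W c d (n + 1 + 1) x = (x - c (n + 2) * √(1 - x ^ 2)) * W c d (n + 1) x
        - d (n + 2) * W c d n x from rfl]
      change d (n + 2) = _ at hd
      simp only [add_assoc, Nat.reduceAdd] at hd hle ⊢
      have e1 := mul_le_mul_of_nonneg_left hle (mul_pos (mul_pos hg1 hg2) hw0).le
      have e2 := mul_le_mul_of_nonneg_left hw (mul_pos hg2 hy2).le
      rw [hd]
      linarith
  obtain ⟨m, rfl⟩ := Nat.exists_eq_add_of_le' hN
  obtain ⟨h0, h1⟩ := key m le_rfl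
  exact (mul_pos (mul_pos (hglt _ hN le_rfl) (hy _ hN le_rfl)) h0).trans_le h1

theorem W_neg (c d : ℕ → ℝ) (x : ℝ) : ∀ n, W (-c) d n (-x) = (-1) ^ n * W c d n x
  | 0 => by simp [W]
  | 1 => by simp [W]; ring
  | n + 2 => by
    rw [W, W, W_neg c d x n, W_neg c d x (n + 1), neg_sq, Pi.neg_apply]
    ring

theorem exists_lt_uPlus_of_W_eq_zero {N : ℕ} (hN : 2 ≤ N) {c d q : ℕ → ℝ}
    (hq : IsFiniteScalingSeq N d q)
    (hqlt : ∀ n, 1 ≤ n → n ≤ N - 1 → q (n + 1) < 1)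
    {x : ℝ} (hx : x ∈ Set.Icc (-1 : ℝ) 1) (hW : W c d N x = 0) :
    ∃ n ∈ Finset.Icc 2 N, x < uPlus (c (n - 1)) (c n) (q n) /
      √(1 + uPlus (c (n - 1)) (c n) (q n) ^ 2) := by
  by_contra! hcon
  have h : ∀ n, 1 ≤ n → n + 1 ≤ N → uPlus (c n) (c (n + 1)) (q (n + 1)) /
      √(1 + uPlus (c n) (c (n + 1)) (q (n + 1)) ^ 2) ≤ x := fun n h1 h2 =>
    hcon (n + 1) (Finset.mem_Icc.2 ⟨by omega, h2⟩)
  have hq0 : ∀ n, 1 ≤ n → n + 1 ≤ N → 0 < q (n + 1) := fun n h1 h2 =>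
    (hq.1 n h1 (by omega)).1
  have hq1 : ∀ n, 1 ≤ n → n + 1 ≤ N → q (n + 1) < 1 := fun n h1 h2 =>
    hqlt n h1 (by omega)
  refine (W_pos_of_scaling (by omega) hq (fun n h1 h2 => ?_) (fun n h1 h2 => ?_)).ne' hW
  · rcases h2.lt_or_eq with h2 | rfl
    · exact sub_mul_sqrt_pos_of_uPlus_le (hq0 n h1 h2) (hq1 n h1 h2) hx (h n h1 h2)
    · obtain ⟨m, rfl⟩ := Nat.exists_eq_add_of_le' h1
      have hm : 1 ≤ m := by omega
      have hle := h m hm le_rfl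
      rw [uPlus_comm] at hle
      exact sub_mul_sqrt_pos_of_uPlus_le (hq0 m hm le_rfl) (hq1 m hm le_rfl) hx hle
  · exact le_mul_of_uPlus_le (hq0 n h1 h2) (hq1 n h1 h2) hx (h n h1 h2)

theorem stmt5 (N : ℕ) (hN : 2 ≤ N) (c d q : ℕ → ℝ)
    (hd : IsFinitePositiveChainSeq N d)
    (hq : IsFiniteScalingSeq N d q)
    (hqlt : ∀ n, 1 ≤ n → n ≤ N - 1 → q (n + 1) < 1) :
    ∀ x ∈ Set.Icc (-1 : ℝ) 1, W c d N x = 0 →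
      (Finset.Icc 2 N).inf' (Finset.nonempty_Icc.mpr hN)
          (fun n => uMinus (c (n - 1)) (c n) (q n) /
            Real.sqrt (1 + uMinus (c (n - 1)) (c n) (q n) ^ 2)) < x ∧
      x < (Finset.Icc 2 N).sup' (Finset.nonempty_Icc.mpr hN)
          (fun n => uPlus (c (n - 1)) (c n) (q n) /
            Real.sqrt (1 + uPlus (c (n - 1)) (c n) (q n) ^ 2)) := by
  intro x hx hW
  refine ⟨(Finset.inf'_lt_iff _).2 ?_,
    (Finset.lt_sup'_iff _).2 (exists_lt_uPlus_of_W_eq_zero hN hq hqlt hx hW)⟩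
  obtain ⟨n, hn, hlt⟩ := exists_lt_uPlus_of_W_eq_zero (c := -c) (x := -x) hN hq hqlt
    ⟨neg_le_neg hx.2, neg_le.2 hx.1⟩ (by rw [W_neg, hW, mul_zero])
  refine ⟨n, hn, ?_⟩
  rw [uMinus_eq_neg_uPlus, neg_sq, neg_div]
  exact neg_lt.2 hlt
end
end

section
/- Let N ≥ 2, let {c_n}_{n≥1} be real and let {d_{n+1}}_{n=1}^{N−1} be a finite positive chain sequence. (a) If c_n + c_{n+1} > 0 for all 1 ≤ n ≤ N−1, then with A_N = min_{1≤n≤N−1} w((c_n c_{n+1} − 1)/(c_n + c_{n+1})), where w(u) = u/√(1+u²), every zero of W_N in [−1,1] lies in (A_N, 1). (b) If c_n + c_{n+1} < 0 for all 1 ≤ n ≤ N−1, then with B_N = max_{1≤n≤N−1} w((c_n c_{n+1} − 1)/(c_n + c_{n+1})), every zero of W_N in [−1,1] lies in (−1, B_N). -/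
noncomputable section

/-- If consecutive values of `x - c_n*sqrt(1-x^2)` have product at least `1`, then each `W n` is
at least `1 - g n` times `(x - c_n*sqrt(1-x^2)) W (n-1)`, in the sense of ratios. -/
lemma W_ratio {N : ℕ} {c d g : ℕ → ℝ} {x : ℝ} (hg1 : 0 ≤ g 1 ∧ g 1 < 1)
    (hg : ∀ n, 2 ≤ n → n ≤ N → 0 < g n ∧ g n < 1)
    (hd : ∀ n, 1 ≤ n → n ≤ N - 1 → d (n + 1) = (1 - g n) * g (n + 1))
    (hb : ∀ n, 1 ≤ n → n ≤ N - 1 →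
      1 ≤ (x - c n * √(1 - x ^ 2)) * (x - c (n + 1) * √(1 - x ^ 2)))
    (n : ℕ) (hn : n + 1 ≤ N) :
    W c d n x ≠ 0 ∧ ∃ r, 1 - g (n + 1) ≤ r ∧ 0 < r ∧
      W c d (n + 1) x = r * (x - c (n + 1) * √(1 - x ^ 2)) * W c d n x := by
  induction n with
  | zero => exact ⟨by simp [W], 1, by linarith [hg1.1], one_pos, by simp [W]⟩
  | succ n ih =>
    obtain ⟨hW, r, hgr, hr, hrW⟩ := ih (by omega)
    have hbb := hb (n + 1) (by omega) (by omega)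
    have hdn := hd (n + 1) (by omega) (by omega)
    obtain ⟨hg0, hg1'⟩ := hg (n + 1 + 1) (by omega) hn
    have hrec : W c d (n + 1 + 1) x = (x - c (n + 1 + 1) * √(1 - x ^ 2)) * W c d (n + 1) x
        - d (n + 1 + 1) * W c d n x := rfl
    generalize x - c (n + 1) * √(1 - x ^ 2) = b at *
    generalize x - c (n + 1 + 1) * √(1 - x ^ 2) = b' at *
    have hb0 : b ≠ 0 := by rintro rfl; norm_num at hbb
    have hb0' : b' ≠ 0 := by rintro rfl; norm_num at hbb
    have hle : 1 - g (n + 1 + 1) ≤ 1 - d (n + 1 + 1) / (r * (b * b')) := by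
      have : d (n + 1 + 1) / (r * (b * b')) ≤ g (n + 1 + 1) := by
        rw [div_le_iff₀ (by positivity), hdn, mul_comm]
        apply mul_le_mul_of_nonneg_left _ hg0.le
        nlinarith
      linarith
    refine ⟨by rw [hrW]; positivity, _, hle, by linarith, ?_⟩
    rw [hrec, hrW]
    field_simp

/-- At a zero of `W N`, some consecutive product of `x - c_n*sqrt(1-x^2)` is less than `1`. -/
lemma exists_mul_lt_one_of_W_eq_zero {N : ℕ} (hN : 2 ≤ N) {c d : ℕ → ℝ}
    (hd : IsFinitePositiveChainSeq N d) {x : ℝ} (hx : W c d N x = 0) :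
    ∃ n, 1 ≤ n ∧ n ≤ N - 1 ∧
      (x - c n * √(1 - x ^ 2)) * (x - c (n + 1) * √(1 - x ^ 2)) < 1 := by
  by_contra! hb
  obtain ⟨g, hg1, hg, hdg⟩ := hd
  obtain ⟨k, rfl⟩ : ∃ k, N = k + 1 + 1 := ⟨N - 2, by omega⟩
  obtain ⟨hW, r, -, hr, hrW⟩ := W_ratio hg1 hg hdg hb (k + 1) le_rfl
  have hbb := hb (k + 1) (by omega) (by omega)
  rw [hx] at hrW
  have hb0 : x - c (k + 1 + 1) * √(1 - x ^ 2) ≠ 0 := fun h => by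
    rw [h] at hbb; norm_num at hbb
  exact mul_ne_zero (mul_ne_zero hr.ne' hb0) hW hrW.symm

lemma mem_Ioo_and_lt_of_mul_lt_one {x a b : ℝ} (hx : x ∈ Set.Icc (-1 : ℝ) 1)
    (h : (x - a * √(1 - x ^ 2)) * (x - b * √(1 - x ^ 2)) < 1) :
    x ∈ Set.Ioo (-1 : ℝ) 1 ∧ a * b - 1 < x / √(1 - x ^ 2) * (a + b) := by
  have hs2 : √(1 - x ^ 2) ^ 2 = 1 - x ^ 2 := Real.sq_sqrt (by nlinarith [hx.1, hx.2])
  have hs : 0 < √(1 - x ^ 2) := by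
    refine (Real.sqrt_nonneg _).lt_of_ne fun h0 => ?_
    rw [← h0] at h hs2
    nlinarith
  have hx2 : 0 < 1 - x ^ 2 := Real.sqrt_pos.mp hs
  refine ⟨⟨by nlinarith [hx.1], by nlinarith [hx.2]⟩, ?_⟩
  rw [div_mul_eq_mul_div, lt_div_iff₀ hs]
  generalize √(1 - x ^ 2) = s at *
  refine lt_of_mul_lt_mul_right ?_ hs.le
  nlinarith

lemma div_sqrt_lt_of_lt_div_sqrt {x v : ℝ} (hx : x ∈ Set.Ioo (-1 : ℝ) 1)
    (h : v < x / √(1 - x ^ 2)) : v / √(1 + v ^ 2) < x := by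
  apply Real.monotone_arcsin.reflect_lt
  rw [← Real.arctan_eq_arcsin, Real.arcsin_eq_arctan hx]
  exact Real.arctan_strictMono h

lemma lt_div_sqrt_of_div_sqrt_lt {x v : ℝ} (hx : x ∈ Set.Ioo (-1 : ℝ) 1)
    (h : x / √(1 - x ^ 2) < v) : x < v / √(1 + v ^ 2) := by
  apply Real.monotone_arcsin.reflect_lt
  rw [← Real.arctan_eq_arcsin, Real.arcsin_eq_arctan hx]
  exact Real.arctan_strictMono h

theorem stmt6 (N : ℕ) (hN : 2 ≤ N) (c d : ℕ → ℝ)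
    (hd : IsFinitePositiveChainSeq N d) :
    ((∀ n, 1 ≤ n → n ≤ N - 1 → 0 < c n + c (n + 1)) →
      ∀ x ∈ Set.Icc (-1 : ℝ) 1, W c d N x = 0 →
        (Finset.Icc 1 (N - 1)).inf' (Finset.nonempty_Icc.mpr (by omega))
            (fun n => ((c n * c (n + 1) - 1) / (c n + c (n + 1))) /
              Real.sqrt (1 + ((c n * c (n + 1) - 1) / (c n + c (n + 1))) ^ 2)) < x ∧
          x < 1) ∧
    ((∀ n, 1 ≤ n → n ≤ N - 1 → c n + c (n + 1) < 0) →
      ∀ x ∈ Set.Icc (-1 : ℝ) 1, W c d N x = 0 →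
        -1 < x ∧
          x < (Finset.Icc 1 (N - 1)).sup' (Finset.nonempty_Icc.mpr (by omega))
            (fun n => ((c n * c (n + 1) - 1) / (c n + c (n + 1))) /
              Real.sqrt (1 + ((c n * c (n + 1) - 1) / (c n + c (n + 1))) ^ 2))) := by
  refine ⟨fun hc x hx hW => ?_, fun hc x hx hW => ?_⟩
  all_goals
    obtain ⟨n, hn1, hnN, hlt⟩ := exists_mul_lt_one_of_W_eq_zero hN hd hW
    obtain ⟨hxI, hv⟩ := mem_Ioo_and_lt_of_mul_lt_one hx hlt
    have hmem : n ∈ Finset.Icc 1 (N - 1) := Finset.mem_Icc.mpr ⟨hn1, hnN⟩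
    have hcn := hc n hn1 hnN
  · refine ⟨(Finset.inf'_lt_iff _).mpr ⟨n, hmem, ?_⟩, hxI.2⟩
    exact div_sqrt_lt_of_lt_div_sqrt hxI ((div_lt_iff₀ hcn).mpr hv)
  · refine ⟨hxI.1, (Finset.lt_sup'_iff _).mpr ⟨n, hmem, ?_⟩⟩
    exact lt_div_sqrt_of_div_sqrt_lt hxI ((lt_div_iff_of_neg hcn).mpr hv)
end
end

section
/- Let N ≥ 2, let {c_n}_{n≥1} be real, let {d_{n+1}}_{n=1}^{N−1} be a finite positive chain sequence, and let {q_{n+1}}_{n=1}^{N−1} be a finite scaling sequence for it with q_{n+1} < 1 for all n. Define q_1^{(1,N)} = q_2, q_n^{(1,N)} = max{q_n, q_{n+1}} for 2 ≤ n ≤ N−1, and q_N^{(1,N)} = q_N. For 1 ≤ n ≤ N set u_{1,n} = (c_n + √(c_n² + 1 − q_n^{(1,N)}))/(1 + √(q_n^{(1,N)})) and v_{1,n} = (1 + √(q_n^{(1,N)}))/(−c_n + √(c_n² + 1 − q_n^{(1,N)})), and define A_N = min_{1≤n≤N} (u_{1,n}² − 1)/(u_{1,n}² + 1) and B_N = max_{1≤n≤N}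 (v_{1,n}² − 1)/(v_{1,n}² + 1). Then every zero of W_N in [−1,1] lies in the open interval (A_N, B_N). -/
noncomputable section

lemma W_neg_apply_neg (c d : ℕ → ℝ) (x : ℝ) :
    ∀ n, W (fun k => -c k) d n (-x) = (-1) ^ n * W c d n x
  | 0 => by simp [W]
  | 1 => by simp only [W, neg_sq]; ring
  | n + 2 => by
      simp only [W, W_neg_apply_neg c d x n, W_neg_apply_neg c d x (n + 1), neg_sq]
      ring

/-- If `q_{n+1} ≤ y_n y_{n+1}` with `y_n = x - c_n √(1 - x²) > 0`, then `W_n(x) > 0` and the ratio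
`W_n(x) / W_{n-1}(x)` is at least `(1 - g_n) y_n`, with `g` the parameters of `d / q`. -/
lemma W_pos_and_ratio {N : ℕ} {c d q g : ℕ → ℝ} {x : ℝ}
    (hg1 : 0 ≤ g 1 ∧ g 1 < 1) (hg : ∀ n, 2 ≤ n → n ≤ N → 0 < g n ∧ g n < 1)
    (hq : ∀ n, 1 ≤ n → n ≤ N - 1 → 0 < q (n + 1))
    (hdq : ∀ n, 1 ≤ n → n ≤ N - 1 → d (n + 1) / q (n + 1) = (1 - g n) * g (n + 1))
    (hy : ∀ n, 1 ≤ n → n ≤ N → 0 < x - c n * Real.sqrt (1 - x ^ 2))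
    (hqy : ∀ n, 1 ≤ n → n ≤ N - 1 → q (n + 1) ≤
      (x - c n * Real.sqrt (1 - x ^ 2)) * (x - c (n + 1) * Real.sqrt (1 - x ^ 2)))
    (n : ℕ) (hn : n + 1 ≤ N) :
    0 < W c d n x ∧
      (1 - g (n + 1)) * (x - c (n + 1) * Real.sqrt (1 - x ^ 2)) * W c d n x
        ≤ W c d (n + 1) x := by
  induction n with
  | zero =>
    have h := hy 1 le_rfl hn
    simp only [W, zero_add]
    exact ⟨one_pos, by nlinarith [mul_nonneg hg1.1 h.le]⟩
  | succ n ih =>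
    obtain ⟨h0, h1⟩ := ih (by omega)
    have hy1 := hy (n + 1) (by omega) (by omega)
    have hq1 := hq (n + 1) (by omega) (by omega)
    have hqy1 := hqy (n + 1) (by omega) (by omega)
    have hd := (div_eq_iff hq1.ne').mp (hdq (n + 1) (by omega) (by omega))
    have hg2 := hg (n + 2) (by omega) hn
    have hglt : 0 < 1 - g (n + 1) := by
      rcases Nat.eq_zero_or_pos n with rfl | hpos
      · linarith [hg1.2]
      · linarith [(hg (n + 1) (by omega) (by omega)).2]
    have hpos : 0 < W c d (n + 1) x := lt_of_lt_of_le (by positivity) h1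
    refine ⟨hpos, ?_⟩
    simp only [W]
    rw [show n + 1 + 1 = n + 2 from rfl] at *
    set y := x - c (n + 1) * Real.sqrt (1 - x ^ 2)
    set z := x - c (n + 2) * Real.sqrt (1 - x ^ 2)
    have hz : 0 < z := hy (n + 2) (by omega) hn
    have key : d (n + 2) * W c d n x ≤ g (n + 2) * z * W c d (n + 1) x :=
      calc d (n + 2) * W c d n x
          = q (n + 2) * ((1 - g (n + 1)) * g (n + 2) * W c d n x) := by rw [hd]; ring
        _ ≤ (y * z) * ((1 - g (n + 1)) * g (n + 2) * W c d n x) := by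
            have := hg2.1
            gcongr
        _ = g (n + 2) * z * ((1 - g (n + 1)) * y * W c d n x) := by ring
        _ ≤ g (n + 2) * z * W c d (n + 1) x := by
            have := hg2.1
            gcongr
    linarith

lemma abs_lt_sqrt_sq_add {c r : ℝ} (hr : r < 1) : |c| < Real.sqrt (c ^ 2 + 1 - r) := by
  rw [← Real.sqrt_sq_eq_abs]
  exact Real.sqrt_lt_sqrt (sq_nonneg c) (by linarith)

lemma sqrt_le_sub_mul_sqrt {c r v x : ℝ} (hr0 : 0 ≤ r) (hr1 : r < 1)
    (hv : v = (1 + Real.sqrt r) / (-c + Real.sqrt (c ^ 2 + 1 - r)))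
    (hx : x ∈ Set.Icc (-1 : ℝ) 1) (hvx : (v ^ 2 - 1) / (v ^ 2 + 1) ≤ x) :
    Real.sqrt r ≤ x - c * Real.sqrt (1 - x ^ 2) := by
  have hp0 := Real.sqrt_nonneg r
  have hp2 := Real.sq_sqrt hr0
  have hp1 : Real.sqrt r < 1 := by rw [Real.sqrt_lt' one_pos]; simpa using hr1
  have hR := abs_lt.mp (abs_lt_sqrt_sq_add (c := c) hr1)
  have hR2 : Real.sqrt (c ^ 2 + 1 - r) ^ 2 = c ^ 2 + 1 - r :=
    Real.sq_sqrt (by nlinarith [sq_nonneg c])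
  set p := Real.sqrt r
  set R := Real.sqrt (c ^ 2 + 1 - r)
  have hRm : 0 < -c + R := by linarith [hR.2]
  have hRp : 0 < c + R := by linarith [hR.1]
  have hv0 : 0 < v := by rw [hv]; positivity
  have hvR : (1 - p) * v = c + R := by
    rw [hv, mul_div_assoc', div_eq_iff hRm.ne']
    linear_combination -hR2 - hp2
  have ha2 : Real.sqrt (1 + x) ^ 2 = 1 + x := Real.sq_sqrt (by linarith [hx.1])
  have hb2 : Real.sqrt (1 - x) ^ 2 = 1 - x := Real.sq_sqrt (by linarith [hx.2])
  have hs : Real.sqrt (1 - x ^ 2) = Real.sqrt (1 + x) * Real.sqrt (1 - x) := by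
    rw [← Real.sqrt_mul (by linarith [hx.1])]; congr 1; ring
  have ha := Real.sqrt_nonneg (1 + x)
  have hb := Real.sqrt_nonneg (1 - x)
  rw [hs]
  set a := Real.sqrt (1 + x)
  set b := Real.sqrt (1 - x)
  have hab : v * b ≤ a := by
    apply le_of_sq_le_sq _ ha
    rw [div_le_iff₀ (by positivity)] at hvx
    rw [mul_pow, ha2, hb2]
    linarith
  have hfac : 0 ≤ (a - v * b) * ((1 - p) * a + (R - c) * b) := by
    have h1 : 0 ≤ (1 - p) * a := mul_nonneg (by linarith) ha
    have h2 : 0 ≤ (R - c) * b := mul_nonneg (by linarith) hb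
    exact mul_nonneg (by linarith) (by linarith)
  have hv' : v * (R - c) = 1 + p := by
    rw [hv]; field_simp; ring
  have : (a - v * b) * ((1 - p) * a + (R - c) * b)
      = (1 - p) * a ^ 2 - 2 * c * (a * b) - (1 + p) * b ^ 2 := by
    linear_combination (-a * b) * hvR - b ^ 2 * hv'
  rw [this, ha2, hb2] at hfac
  linarith

/-- `W_N` is positive to the right of all the points `(v_n² - 1) / (v_n² + 1)`. -/
lemma W_pos_of_forall_le {N : ℕ} (hN : 2 ≤ N) {c d q qq v : ℕ → ℝ} {x : ℝ}
    (hq : IsFiniteScalingSeq N d q)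
    (hqq : ∀ n, 1 ≤ n → n ≤ N → 0 < qq n ∧ qq n < 1)
    (hle : ∀ n, 1 ≤ n → n ≤ N - 1 → q (n + 1) ≤ qq n ∧ q (n + 1) ≤ qq (n + 1))
    (hv : ∀ n, 1 ≤ n → n ≤ N →
      v n = (1 + Real.sqrt (qq n)) / (-c n + Real.sqrt (c n ^ 2 + 1 - qq n)))
    (hx : x ∈ Set.Icc (-1 : ℝ) 1)
    (hvx : ∀ n, 1 ≤ n → n ≤ N → (v n ^ 2 - 1) / (v n ^ 2 + 1) ≤ x) :
    0 < W c d N x := by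
  obtain ⟨hq0, g, hg1, hg, hdq⟩ := hq
  have hy : ∀ n, 1 ≤ n → n ≤ N → Real.sqrt (qq n) ≤ x - c n * Real.sqrt (1 - x ^ 2) :=
    fun n h1 h2 => sqrt_le_sub_mul_sqrt (hqq n h1 h2).1.le (hqq n h1 h2).2 (hv n h1 h2) hx
      (hvx n h1 h2)
  have hy0 : ∀ n, 1 ≤ n → n ≤ N → 0 < x - c n * Real.sqrt (1 - x ^ 2) :=
    fun n h1 h2 => (Real.sqrt_pos.mpr (hqq n h1 h2).1).trans_le (hy n h1 h2)
  obtain ⟨m, rfl⟩ : ∃ m, N = m + 1 := ⟨N - 1, by omega⟩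
  obtain ⟨h0, h1⟩ := W_pos_and_ratio hg1 hg (fun n h1 h2 => (hq0 n h1 h2).1) hdq hy0
    (fun n h1 h2 => by
      rw [← Real.mul_self_sqrt (hq0 n h1 h2).1.le]
      exact mul_le_mul
        ((Real.sqrt_le_sqrt (hle n h1 h2).1).trans (hy n h1 (by omega)))
        ((Real.sqrt_le_sqrt (hle n h1 h2).2).trans (hy (n + 1) (by omega) (by omega)))
        (Real.sqrt_nonneg _) (hy0 n h1 (by omega)).le) m le_rfl
  have hgm : 0 < 1 - g (m + 1) := by linarith [(hg (m + 1) hN le_rfl).2]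
  have hym := hy0 (m + 1) (by omega) le_rfl
  exact lt_of_lt_of_le (by positivity) h1

theorem stmt7 (N : ℕ) (hN : 2 ≤ N) (c d q : ℕ → ℝ)
    (hd : IsFinitePositiveChainSeq N d)
    (hq : IsFiniteScalingSeq N d q)
    (hqlt : ∀ n, 1 ≤ n → n ≤ N - 1 → q (n + 1) < 1)
    (qq u1 v1 : ℕ → ℝ)
    (hqq1 : qq 1 = q 2)
    (hqqmid : ∀ n, 2 ≤ n → n ≤ N - 1 → qq n = max (q n) (q (n + 1)))
    (hqqN : qq N = q N)
    (hu1 : ∀ n, 1 ≤ n → n ≤ N →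
      u1 n = (c n + Real.sqrt (c n ^ 2 + 1 - qq n)) / (1 + Real.sqrt (qq n)))
    (hv1 : ∀ n, 1 ≤ n → n ≤ N →
      v1 n = (1 + Real.sqrt (qq n)) / (-c n + Real.sqrt (c n ^ 2 + 1 - qq n))) :
    ∀ x ∈ Set.Icc (-1 : ℝ) 1, W c d N x = 0 →
      (Finset.Icc 1 N).inf' (Finset.nonempty_Icc.mpr (by omega))
          (fun n => (u1 n ^ 2 - 1) / (u1 n ^ 2 + 1)) < x ∧
      x < (Finset.Icc 1 N).sup' (Finset.nonempty_Icc.mpr (by omega))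
          (fun n => (v1 n ^ 2 - 1) / (v1 n ^ 2 + 1)) := by
  have hqb : ∀ n, 2 ≤ n → n ≤ N → 0 < q n ∧ q n < 1 := fun n h1 h2 => by
    obtain ⟨m, rfl⟩ : ∃ m, n = m + 1 := ⟨n - 1, by omega⟩
    exact ⟨(hq.1 m (by omega) (by omega)).1, hqlt m (by omega) (by omega)⟩
  have hqq : ∀ n, 1 ≤ n → n ≤ N → 0 < qq n ∧ qq n < 1 := fun n h1 h2 => by
    rcases eq_or_ne n 1 with rfl | hn1
    · exact hqq1 ▸ hqb 2 le_rfl hN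
    rcases eq_or_ne n N with rfl | hnN
    · exact hqqN ▸ hqb n hN le_rfl
    rw [hqqmid n (by omega) (by omega)]
    have ha := hqb n (by omega) (by omega)
    have hb := hqb (n + 1) (by omega) (by omega)
    exact ⟨lt_max_of_lt_left ha.1, max_lt ha.2 hb.2⟩
  have hle : ∀ n, 1 ≤ n → n ≤ N - 1 → q (n + 1) ≤ qq n ∧ q (n + 1) ≤ qq (n + 1) := by
    intro n h1 h2
    constructor
    · rcases eq_or_ne n 1 with rfl | hn1
      · exact hqq1.ge
      · rw [hqqmid n (by omega) h2]
        exact le_max_right _ _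
    · rcases eq_or_ne (n + 1) N with h | hnN
      · rw [h, hqqN]
      · rw [hqqmid (n + 1) (by omega) (by omega)]
        exact le_max_left _ _
  intro x hx hW
  constructor
  · by_contra! hcon
    rw [Finset.le_inf'_iff] at hcon
    have hpos := W_pos_of_forall_le (c := fun k => -c k) (x := -x) (v := fun n => (u1 n)⁻¹)
      hN hq hqq hle
      (fun n h1 h2 => by rw [hu1 n h1 h2, inv_div]; simp)
      ⟨by linarith [hx.2], by linarith [hx.1]⟩
      (fun n h1 h2 => by
        have hu : 0 < u1 n := by
          have := (abs_lt.mp (abs_lt_sqrt_sq_add (c := c n) (hqq n h1 h2).2)).1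
          have : 0 < c n + Real.sqrt (c n ^ 2 + 1 - qq n) := by linarith
          rw [hu1 n h1 h2]
          positivity
        have hxn := hcon n (Finset.mem_Icc.mpr ⟨h1, h2⟩)
        have : ((u1 n)⁻¹ ^ 2 - 1) / ((u1 n)⁻¹ ^ 2 + 1) = -((u1 n ^ 2 - 1) / (u1 n ^ 2 + 1)) := by
          field_simp
          ring
        rw [this]
        linarith)
    simp [W_neg_apply_neg, hW] at hpos
  · by_contra! hcon
    rw [Finset.sup'_le_iff] at hcon
    have hpos := W_pos_of_forall_le hN hq hqq hle hv1 hx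
      (fun n h1 h2 => hcon n (Finset.mem_Icc.mpr ⟨h1, h2⟩))
    exact hpos.ne' hW
end
end

section
/- Let N ≥ 2, let {c_n}_{n≥1} be real and let {d_{n+1}}_{n=1}^{N−1} be a finite positive chain sequence. (a) If c_n > 0 for all 1 ≤ n ≤ N, then with A_N = min_{1≤n≤N} (c_n² − 1)/(c_n² + 1), every zero of W_N in [−1,1] lies in (A_N, 1). (b) If c_n < 0 for all 1 ≤ n ≤ N, then with B_N = max_{1≤n≤N} (1 − c_n²)/(1 + c_n²), every zero of W_N in [−1,1] lies in (−1, B_N). -/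
noncomputable section

/-- One step of the chain-sequence estimate: `|W (n + 1)| ≥ (1 - g (n + 1)) |W n|`. -/
theorem W_abs_lower_bound {N : ℕ} {c d g : ℕ → ℝ} {x : ℝ} (hg1 : 0 ≤ g 1 ∧ g 1 < 1)
    (hg : ∀ n, 2 ≤ n → n ≤ N → 0 < g n ∧ g n < 1)
    (hd : ∀ n, 1 ≤ n → n ≤ N - 1 → d (n + 1) = (1 - g n) * g (n + 1))
    (hu : ∀ n, 1 ≤ n → n ≤ N → 1 ≤ |x - c n * Real.sqrt (1 - x ^ 2)|) (n : ℕ) (hn : n + 1 ≤ N) :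
    0 < |W c d n x| ∧ (1 - g (n + 1)) * |W c d n x| ≤ |W c d (n + 1) x| := by
  induction n with
  | zero =>
    have h := hu 1 le_rfl hn
    simp only [W, zero_add, abs_one, mul_one]
    exact ⟨one_pos, by linarith [hg1.1]⟩
  | succ n ih =>
    obtain ⟨hpos, hle⟩ := ih (by omega)
    have hgn : 0 < 1 - g (n + 1) := by
      rcases Nat.eq_zero_or_pos n with rfl | h
      · simpa using hg1.2
      · linarith [(hg (n + 1) (by omega) (by omega)).2]
    have hg2 := (hg (n + 2) (by omega) hn).1
    refine ⟨(mul_pos hgn hpos).trans_le hle, ?_⟩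
    have hdn : d (n + 2) = (1 - g (n + 1)) * g (n + 2) := hd (n + 1) (by omega) (by omega)
    have hmul : |W c d (n + 1) x| ≤
        |(x - c (n + 2) * Real.sqrt (1 - x ^ 2)) * W c d (n + 1) x| := by
      rw [abs_mul]
      exact le_mul_of_one_le_left (abs_nonneg _) (hu (n + 2) (by omega) hn)
    have hdW : |d (n + 2) * W c d n x| ≤ g (n + 2) * |W c d (n + 1) x| := by
      rw [abs_mul, hdn, abs_of_pos (mul_pos hgn hg2)]
      nlinarith
    calc (1 - g (n + 2)) * |W c d (n + 1) x|
        ≤ |(x - c (n + 2) * Real.sqrt (1 - x ^ 2)) * W c d (n + 1) x|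
          - |d (n + 2) * W c d n x| := by linarith
      _ ≤ |W c d (n + 2) x| := abs_sub_abs_le_abs_sub _ _

theorem W_ne_zero_of_one_le_abs {N : ℕ} (hN : 2 ≤ N) {c d : ℕ → ℝ} {x : ℝ}
    (hd : IsFinitePositiveChainSeq N d)
    (hu : ∀ n, 1 ≤ n → n ≤ N → 1 ≤ |x - c n * Real.sqrt (1 - x ^ 2)|) : W c d N x ≠ 0 := by
  obtain ⟨g, hg1, hg, hdg⟩ := hd
  obtain ⟨n, rfl⟩ : ∃ n, N = n + 1 := ⟨N - 1, by omega⟩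
  obtain ⟨hpos, hle⟩ := W_abs_lower_bound hg1 hg hdg hu n le_rfl
  have h := (hg (n + 1) hN le_rfl).2
  exact abs_pos.mp ((mul_pos (by linarith) hpos).trans_le hle)

theorem one_add_le_mul_sqrt {a x : ℝ} (ha : 0 < a) (hx : x ∈ Set.Icc (-1 : ℝ) 1)
    (h : x ≤ (a ^ 2 - 1) / (a ^ 2 + 1)) : 1 + x ≤ a * Real.sqrt (1 - x ^ 2) := by
  obtain ⟨h1, h2⟩ := hx
  rw [le_div_iff₀ (by positivity)] at h
  have hs : Real.sqrt (1 - x ^ 2) ^ 2 = 1 - x ^ 2 := Real.sq_sqrt (by nlinarith)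
  refine abs_le_of_sq_le_sq' ?_ (by positivity) |>.2
  rw [mul_pow, hs]
  nlinarith [mul_nonneg (by linarith : 0 ≤ 1 + x) (by linarith : 0 ≤ a ^ 2 - 1 - x * (a ^ 2 + 1))]

theorem stmt8 (N : ℕ) (hN : 2 ≤ N) (c d : ℕ → ℝ)
    (hd : IsFinitePositiveChainSeq N d) :
    ((∀ n, 1 ≤ n → n ≤ N → 0 < c n) →
      ∀ x ∈ Set.Icc (-1 : ℝ) 1, W c d N x = 0 →
        (Finset.Icc 1 N).inf' (Finset.nonempty_Icc.mpr (by omega))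
            (fun n => (c n ^ 2 - 1) / (c n ^ 2 + 1)) < x ∧ x < 1) ∧
    ((∀ n, 1 ≤ n → n ≤ N → c n < 0) →
      ∀ x ∈ Set.Icc (-1 : ℝ) 1, W c d N x = 0 →
        -1 < x ∧
          x < (Finset.Icc 1 N).sup' (Finset.nonempty_Icc.mpr (by omega))
            (fun n => (1 - c n ^ 2) / (1 + c n ^ 2))) := by
  refine ⟨fun hc x hx hW => ⟨?_, ?_⟩, fun hc x hx hW => ⟨?_, ?_⟩⟩
  · by_contra! h
    refine W_ne_zero_of_one_le_abs hN hd (fun n h1 hn => ?_) hW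
    have := one_add_le_mul_sqrt (hc n h1 hn) hx
      (h.trans (Finset.inf'_le _ (Finset.mem_Icc.mpr ⟨h1, hn⟩)))
    exact le_abs.mpr (Or.inr (by linarith))
  · refine lt_of_le_of_ne hx.2 ?_
    rintro rfl
    exact W_ne_zero_of_one_le_abs hN hd (fun n _ _ => by simp) hW
  · refine lt_of_le_of_ne hx.1 ?_
    rintro rfl
    exact W_ne_zero_of_one_le_abs hN hd (fun n _ _ => by simp) hW
  · by_contra! h
    refine W_ne_zero_of_one_le_abs hN hd (fun n h1 hn => ?_) hW
    have hB := (Finset.le_sup' (fun n => (1 - c n ^ 2) / (1 + c n ^ 2))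
      (Finset.mem_Icc.mpr ⟨h1, hn⟩)).trans h
    have hneg : -x ≤ ((-c n) ^ 2 - 1) / ((-c n) ^ 2 + 1) := by
      rw [neg_le, ← neg_div, neg_sub, neg_sq, add_comm]
      exact hB
    have := one_add_le_mul_sqrt (neg_pos.mpr (hc n h1 hn))
      (⟨by linarith [hx.2], by linarith [hx.1]⟩ : -x ∈ Set.Icc (-1 : ℝ) 1) hneg
    rw [neg_sq] at this
    exact le_abs.mpr (Or.inl (by linarith))
end
end

section
/- Let N ≥ 2 and let {d_{n+1}}_{n=1}^{N−1} be a finite positive chain sequence. Let W_n be the polynomials defined by W_0(x) = 1, W_1(x) = x and W_{n+1}(x) = x W_n(x) − d_{n+1} W_{n−1}(x) for 1 ≤ n ≤ N−1, and let x_{N,1} be the largest real zero of W_N. Then for q with 0 < q ≤ 1, the constant sequence {q}_{n=1}^{N−1} is a finite scaling sequence for {d_{n+1}}_{n=1}^{N−1} (i.e., {d_{n+1}/q}_{n=1}^{N−1} is a finite positive chain sequence) if and only if q > x_{N,1}². -/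
noncomputable section

section ZeroCoefficients

variable {d : ℕ → ℝ}

lemma W_zero_coeff_one (d : ℕ → ℝ) (x : ℝ) : W (fun _ => 0) d 1 x = x := by
  simp [W]

lemma W_zero_coeff_add_two (d : ℕ → ℝ) (n : ℕ) (x : ℝ) :
    W (fun _ => 0) d (n + 2) x
      = x * W (fun _ => 0) d (n + 1) x - d (n + 2) * W (fun _ => 0) d n x := by
  simp [W]

lemma W_zero_coeff_neg (d : ℕ → ℝ) (n : ℕ) (x : ℝ) :
    W (fun _ => 0) d n (-x) = (-1) ^ n * W (fun _ => 0) d n x := by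
  induction n using Nat.twoStepInduction with
  | zero => simp [W]
  | one => simp [W_zero_coeff_one]
  | more n ih₀ ih₁ =>
    rw [W_zero_coeff_add_two, W_zero_coeff_add_two, ih₀, ih₁]
    ring

lemma continuous_W_zero_coeff (d : ℕ → ℝ) (n : ℕ) : Continuous (W (fun _ => 0) d n) := by
  induction n using Nat.twoStepInduction with
  | zero => exact continuous_const
  | one => exact continuous_id.congr fun x => (W_zero_coeff_one d x).symm
  | more n ih₀ ih₁ =>
    exact ((continuous_id.mul ih₁).sub (continuous_const.mul ih₀)).congr
      fun x => (W_zero_coeff_add_two d n x).symm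

/-- A chain sequence `d / q` forces every `W_n` to be positive on `[√q, ∞)`. -/
lemma IsFinitePositiveChainSeq.W_pos {N : ℕ} {q x : ℝ}
    (h : IsFinitePositiveChainSeq N (fun k => d k / q)) (hq : 0 < q) (hx : 0 < x)
    (hqx : q ≤ x ^ 2) {n : ℕ} (hn : n ≤ N) : 0 < W (fun _ => 0) d n x := by
  obtain ⟨g, hg1, hg, hdg⟩ := h
  have hlt : ∀ m, m + 1 ≤ N → g (m + 1) < 1 := by
    intro m hm
    rcases m with _ | m
    · exact hg1.2
    · exact (hg (m + 2) (by omega) hm).2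
  have key : ∀ m, m + 1 ≤ N → 0 < W (fun _ => 0) d m x ∧
      x * (1 - g (m + 1)) * W (fun _ => 0) d m x ≤ W (fun _ => 0) d (m + 1) x := by
    intro m
    induction m with
    | zero =>
      intro _
      rw [zero_add, W_zero_coeff_one]
      simp only [W]
      exact ⟨one_pos, by nlinarith [hg1.1]⟩
    | succ m ih =>
      intro hm
      obtain ⟨hpos, hle⟩ := ih (by omega)
      have h1 : 0 < 1 - g (m + 1) := sub_pos.2 (hlt m (by omega))
      have hpos' : 0 < W (fun _ => 0) d (m + 1) x := lt_of_lt_of_le (by positivity) hle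
      refine ⟨hpos', ?_⟩
      have hg2 := (hg (m + 2) (by omega) hm).1
      have hd : d (m + 2) = q * ((1 - g (m + 1)) * g (m + 2)) := by
        have := hdg (m + 1) (by omega) (by omega)
        rw [← this]
        field_simp
      rw [W_zero_coeff_add_two, hd]
      have h2 : q * ((1 - g (m + 1)) * g (m + 2)) * W (fun _ => 0) d m x
          ≤ x ^ 2 * ((1 - g (m + 1)) * g (m + 2)) * W (fun _ => 0) d m x := by gcongr
      have h3 := mul_le_mul_of_nonneg_left hle (mul_pos hx hg2).le
      change x * (1 - g (m + 2)) * _ ≤ _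
      linarith
  rcases n with _ | n
  · simp [W]
  · obtain ⟨hpos, hle⟩ := key n hn
    have h1 : 0 < 1 - g (n + 1) := sub_pos.2 (hlt n hn)
    exact lt_of_lt_of_le (by positivity) hle

/-- If all `W_n`, `n ≤ N`, are positive on `[b, ∞)`, they are already positive to the right of the
zeros of `W_N`. -/
lemma W_pos_of_forall_zero_lt {N : ℕ} (hd : ∀ n, n + 2 ≤ N → 0 < d (n + 2)) {b t : ℝ}
    (hb : ∀ x, b ≤ x → ∀ n ≤ N, 0 < W (fun _ => 0) d n x)
    (ht : ∀ y, W (fun _ => 0) d N y = 0 → y < t) {n : ℕ} (hn : n ≤ N) :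
    0 < W (fun _ => 0) d n t := by
  by_contra! hneg
  let A : Set ℝ := Set.Icc t b ∩ ⋃ k ∈ Set.Iic N, {x | W (fun _ => 0) d k x ≤ 0}
  have hmem : ∀ x, t ≤ x → ∀ k ≤ N, W (fun _ => 0) d k x ≤ 0 → x ∈ A := by
    intro x hx k hk hW
    refine ⟨⟨hx, ?_⟩, Set.mem_biUnion (show k ∈ Set.Iic N from hk) hW⟩
    by_contra! h
    exact (hb x h.le k hk).not_ge hW
  have hA : IsCompact A := isCompact_Icc.inter_right <|
    (Set.finite_Iic N).isClosed_biUnion fun k _ =>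
      isClosed_le (continuous_W_zero_coeff d k) continuous_const
  obtain ⟨s, hsA, hs⟩ := hA.exists_isGreatest ⟨t, hmem t le_rfl n hn hneg⟩
  have hts : t ≤ s := hsA.1.1
  have hnonneg : ∀ k ≤ N, 0 ≤ W (fun _ => 0) d k s := by
    intro k hk
    have htend : Filter.Tendsto (W (fun _ => 0) d k) (nhdsWithin s (Set.Ioi s))
        (nhds (W (fun _ => 0) d k s)) :=
      (continuous_W_zero_coeff d k).continuousAt.mono_left nhdsWithin_le_nhds
    refine ge_of_tendsto htend ?_
    filter_upwards [self_mem_nhdsWithin] with y (hy : s < y)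
    by_contra! h
    exact hy.not_ge (hs (hmem y (hts.trans hy.le) k hk h.le))
  have hex : ∃ k, k ≤ N ∧ W (fun _ => 0) d k s ≤ 0 := by
    simpa [A] using hsA.2
  classical
  obtain ⟨hkN, hk⟩ := Nat.find_spec hex
  have hmin := fun m => Nat.find_min hex (m := m)
  generalize Nat.find hex = k at hkN hk hmin
  have hk0 : W (fun _ => 0) d k s = 0 := le_antisymm hk (hnonneg k hkN)
  have hlt : k < N := by
    refine lt_of_le_of_ne hkN ?_
    rintro rfl
    exact (ht s hk0).not_ge hts
  rcases k with _ | m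
  · simp [W] at hk0
  · have hm : 0 < W (fun _ => 0) d m s := by
      by_contra! h
      exact hmin m (Nat.lt_succ_self m) ⟨by omega, h⟩
    have h2 := hnonneg (m + 2) hlt
    rw [W_zero_coeff_add_two, hk0] at h2
    have := mul_pos (hd m hlt) hm
    linarith

/-- Positivity of the `W_n` at `t` yields the minimal parameters of `d / t ^ 2`. -/
lemma isFinitePositiveChainSeq_div_sq {N : ℕ} (hd : ∀ n, n + 2 ≤ N → 0 < d (n + 2)) {t : ℝ}
    (ht : 0 < t) (hW : ∀ n ≤ N, 0 < W (fun _ => 0) d n t) :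
    IsFinitePositiveChainSeq N (fun k => d k / t ^ 2) := by
  have hstep : ∀ m, m + 2 ≤ N →
      1 - W (fun _ => 0) d (m + 2) t / (t * W (fun _ => 0) d (m + 1) t)
        = d (m + 2) * W (fun _ => 0) d m t / (t * W (fun _ => 0) d (m + 1) t) := by
    intro m hm
    have := hW (m + 1) (by omega)
    rw [W_zero_coeff_add_two]
    field_simp
    ring
  refine ⟨fun n => 1 - W (fun _ => 0) d n t / (t * W (fun _ => 0) d (n - 1) t), ?_, ?_, ?_⟩
  · simp [W, ht.ne']
  · intro n hn hnN
    obtain ⟨m, rfl⟩ := Nat.exists_eq_add_of_le' hn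
    have h0 := hW m (by omega)
    have h1 := hW (m + 1) (by omega)
    have h2 := hW (m + 2) hnN
    have h3 := hd m hnN
    refine ⟨?_, sub_lt_self _ ?_⟩
    · change 0 < 1 - W (fun _ => 0) d (m + 2) t / (t * W (fun _ => 0) d (m + 1) t)
      rw [hstep m hnN]
      positivity
    · change 0 < W (fun _ => 0) d (m + 2) t / (t * W (fun _ => 0) d (m + 1) t)
      positivity
  · intro n hn hnN
    obtain ⟨m, rfl⟩ := Nat.exists_eq_add_of_le' hn
    have h0 := hW m (by omega)
    have h1 := hW (m + 1) (by omega)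
    change d (m + 2) / t ^ 2 = (1 - (1 - W (fun _ => 0) d (m + 1) t / (t * W (fun _ => 0) d m t)))
      * (1 - W (fun _ => 0) d (m + 2) t / (t * W (fun _ => 0) d (m + 1) t))
    rw [hstep m (by omega)]
    field_simp
    ring

end ZeroCoefficients

lemma IsFinitePositiveChainSeq.pos {N : ℕ} {d : ℕ → ℝ} (h : IsFinitePositiveChainSeq N d)
    {n : ℕ} (hn : n + 2 ≤ N) : 0 < d (n + 2) := by
  obtain ⟨g, hg1, hg, hdg⟩ := h
  have hlt : g (n + 1) < 1 := by
    rcases n with _ | n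
    · exact hg1.2
    · exact (hg (n + 2) (by omega) (by omega)).2
  rw [hdg (n + 1) (by omega) (by omega)]
  exact mul_pos (sub_pos.2 hlt) (hg (n + 2) (by omega) hn).1

theorem stmt9 (N : ℕ) (hN : 2 ≤ N) (d : ℕ → ℝ)
    (hd : IsFinitePositiveChainSeq N d)
    (x1 : ℝ) (hroot : W (fun _ => 0) d N x1 = 0)
    (hmax : ∀ y : ℝ, W (fun _ => 0) d N y = 0 → y ≤ x1)
    (q : ℝ) (hq0 : 0 < q) (hq1 : q ≤ 1) :
    IsFiniteScalingSeq N d (fun _ => q) ↔ x1 ^ 2 < q := by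
  have hx1 : 0 ≤ x1 := by
    have := hmax (-x1) (by rw [W_zero_coeff_neg, hroot, mul_zero])
    linarith
  constructor
  · rintro ⟨-, h⟩
    by_contra! hle
    have hpos : 0 < x1 := lt_of_le_of_ne hx1 (by rintro rfl; norm_num at hle; linarith)
    exact (h.W_pos hq0 hpos hle le_rfl).ne' hroot
  · intro hlt
    have hd1 : IsFinitePositiveChainSeq N (fun k => d k / 1) := by simpa using hd
    have hpos : ∀ n ≤ N, 0 < W (fun _ => 0) d n (Real.sqrt q) := fun n hn =>
      W_pos_of_forall_zero_lt (fun m hm => hd.pos hm) (b := 1)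
        (fun x hx m hm => hd1.W_pos one_pos (by linarith) (by nlinarith) hm)
        (fun y hy => (hmax y hy).trans_lt (Real.lt_sqrt_of_sq_lt hlt)) hn
    refine ⟨fun _ _ _ => ⟨hq0, hq1⟩, ?_⟩
    have := isFinitePositiveChainSeq_div_sq (fun m hm => hd.pos hm) (Real.sqrt_pos.2 hq0) hpos
    rwa [Real.sq_sqrt hq0.le] at this
end
end

section
/- For N ≥ 2 and a real constant d > 0, the constant sequence {d}_{n=1}^{N−1} is a finite positive chain sequence if and only if d < 1/(4cos²(π/(N+1))). In other words, the supremum of constants d such that the constant sequence of N−1 elements equal to d is a finite positive chain sequence equals 1/(4cos²(π/(N+1))). -/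
noncomputable section

/-- The constant sequence `d` is a finite positive chain sequence of length `N` exactly when `d < D`,
as soon as the recursion `k (n + 1) = 1 - D / k n` started at `1` first vanishes at index `N`. -/
theorem isFinitePositiveChainSeq_const_iff {N : ℕ} (hN : 2 ≤ N) {D : ℝ} (hD : 0 < D) {k : ℕ → ℝ}
    (k_one : k 1 = 1) (k_pos : ∀ n, 1 ≤ n → n < N → 0 < k n) (k_last : k N = 0)
    (k_succ : ∀ n, 1 ≤ n → n < N → k (n + 1) = 1 - D / k n) {d : ℝ} (hd : 0 < d) :
    IsFinitePositiveChainSeq N (fun _ => d) ↔ d < D := by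
  constructor
  · rintro ⟨g, ⟨hg0, hg1⟩, hg, hrec⟩
    by_contra! hDd
    have hpos : ∀ n, 1 ≤ n → n ≤ N → 0 < 1 - g n := by
      intro n h1 h2
      rcases h1.eq_or_lt with rfl | h
      · linarith
      · linarith [(hg n h h2).2]
    have hle : ∀ n, 1 ≤ n → n ≤ N → 1 - g n ≤ k n := by
      intro n h1
      induction n, h1 using Nat.le_induction with
      | base => intro _; linarith
      | succ n h1 ih =>
        intro h2
        have hn := hpos n h1 (by omega)
        have hgn : g (n + 1) = d / (1 - g n) := by
          rw [eq_div_iff hn.ne', mul_comm]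
          exact (hrec n h1 (by omega)).symm
        have : D / k n ≤ d / (1 - g n) :=
          div_le_div₀ hd.le hDd hn (ih (by omega))
        rw [k_succ n h1 (by omega)]
        linarith
    linarith [hpos N (by omega) le_rfl, hle N (by omega) le_rfl]
  · intro hdD
    let f : ℕ → ℝ := fun n => Nat.rec 1 (fun _ x => 1 - d / x) n
    have f_succ (n : ℕ) : f (n + 1) = 1 - d / f n := rfl
    have hlt : ∀ n, 1 ≤ n → n < N → k (n + 1) < f n ∧ f n < 1 := by
      intro n h1
      induction n, h1 using Nat.le_induction with
      | base =>
        intro h2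
        have : f 1 = 1 - d := by simp [f]
        have := k_succ 1 le_rfl h2
        rw [k_one, div_one] at this
        constructor <;> linarith
      | succ n h1 ih =>
        intro h2
        have ih := (ih (by omega)).1
        have hk := k_pos (n + 1) (by omega) h2
        have hf : 0 < f n := hk.trans ih
        have : d / f n < D / k (n + 1) :=
          div_lt_div₀ hdD ih.le hD.le hk
        rw [f_succ, k_succ (n + 1) (by omega) h2]
        exact ⟨by linarith, by linarith [div_pos hd hf]⟩
    have hpos (n : ℕ) (h2 : n < N) : 0 < f n := by
      rcases n.eq_zero_or_pos with rfl | h1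
      · exact one_pos
      · refine lt_of_le_of_lt ?_ (hlt n h1 h2).1
        rcases Nat.lt_or_ge (n + 1) N with h | h
        · exact (k_pos _ (by omega) h).le
        · rw [show n + 1 = N by omega, k_last]
    refine ⟨fun n => 1 - f (n - 1), ⟨?_, ?_⟩, ?_, ?_⟩
    · simp [f]
    · simp [f]
    · intro n h1 h2
      exact ⟨by linarith [(hlt (n - 1) (by omega) (by omega)).2],
        by linarith [hpos (n - 1) (by omega)]⟩
    · intro n h1 h2
      obtain ⟨m, rfl⟩ := Nat.exists_eq_add_of_le' h1
      have := hpos m (by omega)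
      simp only [Nat.add_sub_cancel, f_succ]
      field_simp
      ring

theorem stmt12 (N : ℕ) (hN : 2 ≤ N) :
    (∀ d : ℝ, 0 < d →
      (IsFinitePositiveChainSeq N (fun _ => d) ↔
        d < 1 / (4 * Real.cos (Real.pi / (N + 1)) ^ 2))) ∧
    sSup {d : ℝ | 0 < d ∧ IsFinitePositiveChainSeq N (fun _ => d)} =
      1 / (4 * Real.cos (Real.pi / (N + 1)) ^ 2) := by
  set θ : ℝ := Real.pi / (N + 1) with hθ
  have hN' : (2 : ℝ) ≤ N := by exact_mod_cast hN
  have hNθ : (N + 1 : ℝ) * θ = Real.pi := by rw [hθ]; field_simp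
  have hθ0 : 0 < θ := by positivity
  have hc : 0 < Real.cos θ := by
    apply Real.cos_pos_of_mem_Ioo
    constructor <;> nlinarith
  have hS : ∀ n : ℕ, 1 ≤ n → n ≤ N → 0 < Real.sin (n * θ) := by
    intro n h1 h2
    have h1' : (1 : ℝ) ≤ n := by exact_mod_cast h1
    have h2' : (n : ℝ) ≤ N := by exact_mod_cast h2
    apply Real.sin_pos_of_pos_of_lt_pi <;> nlinarith
  have hD : 0 < 1 / (4 * Real.cos θ ^ 2) := by positivity
  have key : ∀ d : ℝ, 0 < d →
      (IsFinitePositiveChainSeq N (fun _ => d) ↔ d < 1 / (4 * Real.cos θ ^ 2)) := by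
    intro d hd
    refine isFinitePositiveChainSeq_const_iff hN hD
      (k := fun n => Real.sin ((n + 1 : ℕ) * θ) / (2 * Real.cos θ * Real.sin (n * θ)))
      ?_ ?_ ?_ ?_ hd
    · have h := hS 1 le_rfl (by omega)
      simp only [Nat.cast_one, one_mul] at h
      have h2 : ((1 + 1 : ℕ) : ℝ) * θ = 2 * θ := by norm_num
      simp only [h2, Real.sin_two_mul, Nat.cast_one, one_mul]
      field_simp
    · intro n h1 h2
      have := hS n h1 h2.le
      have := hS (n + 1) (by omega) h2
      positivity
    · simp [hNθ]
    · intro n h1 h2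
      have h3 := hS n h1 h2.le
      have h4 := hS (n + 1) (by omega) h2
      have hrec : Real.sin ((n + 1 + 1 : ℕ) * θ) =
          2 * Real.cos θ * Real.sin ((n + 1 : ℕ) * θ) - Real.sin (n * θ) := by
        have e1 : ((n + 1 + 1 : ℕ) : ℝ) * θ = (n + 1 : ℕ) * θ + θ := by push_cast; ring
        have e2 : (n : ℝ) * θ = (n + 1 : ℕ) * θ - θ := by push_cast; ring
        rw [e1, e2, Real.sin_add, Real.sin_sub]
        ring
      simp only [hrec]
      field_simp
      ring
  refine ⟨key, ?_⟩
  have hset : {d : ℝ | 0 < d ∧ IsFinitePositiveChainSeq N (fun _ => d)} =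
      Set.Ioo 0 (1 / (4 * Real.cos θ ^ 2)) := by
    ext d
    exact and_congr_right (key d)
  rw [hset, csSup_Ioo hD]
end
end

section
/- Let F_n ∈ Ω_n, let 1 ≤ r ≤ n, and let x_j = cos(θ_j/2), j = 1, …, r, be distinct zeros of F_n lying in (−1,1), with θ_j ∈ (0, 2π). Then there exists G_{n−r} ∈ Ω_{n−r} such that F_n(x) = G_{n−r}(x) · ∏_{j=1}^{r} (x − β_j √(1−x²)) for all x ∈ [−1,1], where β_j = cot(θ_j/2). -/
noncomputable section

/-- Membership in the class `Ω_n`: for `n ≥ 1`, `F : [-1,1] → ℝ` has the form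
`F(x) = p(x) + √(1-x²) r(x)` with `deg p ≤ n`, `p(-x) = (-1)ⁿ p(x)`, `deg r ≤ n-1`,
`r(-x) = (-1)^{n-1} r(x)`; `Ω_0` consists of the constant functions. -/
def MemOmega : ℕ → (ℝ → ℝ) → Prop
  | 0, F => ∃ a : ℝ, ∀ x ∈ Set.Icc (-1 : ℝ) 1, F x = a
  | n + 1, F => ∃ p r : Polynomial ℝ, p.natDegree ≤ n + 1 ∧ r.natDegree ≤ n ∧
      (∀ x : ℝ, p.eval (-x) = (-1 : ℝ) ^ (n + 1) * p.eval x) ∧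
      (∀ x : ℝ, r.eval (-x) = (-1 : ℝ) ^ n * r.eval x) ∧
      ∀ x ∈ Set.Icc (-1 : ℝ) 1, F x = p.eval x + Real.sqrt (1 - x ^ 2) * r.eval x

open Polynomial in
theorem natDegree_le_iff_degree_lt_add_one (q : ℝ[X]) (n : ℕ) :
    q.natDegree ≤ n ↔ q.degree < (n + 1 : ℕ) := by
  rcases eq_or_ne q 0 with rfl | hq
  · simp
  · rw [← natDegree_lt_iff_degree_lt hq, Nat.lt_succ_iff]

open Polynomial in
/-- A description of `Ω_n` that is uniform in `n`. -/
theorem memOmega_iff (n : ℕ) (F : ℝ → ℝ) :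
    MemOmega n F ↔ ∃ p q : ℝ[X], p.degree ≤ n ∧ q.degree < n ∧
      p.comp (-X) = (-1) ^ n * p ∧ q.comp (-X) = -((-1) ^ n * q) ∧
      ∀ x ∈ Set.Icc (-1 : ℝ) 1, F x = p.eval x + Real.sqrt (1 - x ^ 2) * q.eval x := by
  cases n with
  | zero =>
    constructor
    · rintro ⟨a, ha⟩
      exact ⟨C a, 0, by simpa using degree_C_le, by simp, by simp, by simp, by simpa using ha⟩
    · rintro ⟨p, q, hp, hq, -, -, h⟩
      have hq0 : q = 0 := by
        rw [← degree_eq_bot]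
        simpa using hq
      refine ⟨p.coeff 0, fun x hx => ?_⟩
      rw [h x hx, hq0]
      nth_rw 1 [eq_C_of_degree_le_zero (p := p) (by simpa using hp)]
      simp
  | succ n =>
    refine exists_congr fun p => exists_congr fun q => ?_
    refine and_congr natDegree_le_iff_degree_le
      (and_congr ?_ (and_congr ?_ (and_congr ?_ Iff.rfl)))
    · exact natDegree_le_iff_degree_lt_add_one q n
    · constructor
      · exact fun h => Polynomial.funext fun x => by simpa using h x
      · exact fun h x => by simpa using congrArg (eval x) h
    · constructor
      · exact fun h => Polynomial.funext fun x => by simpa [pow_succ] using h x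
      · exact fun h x => by simpa [pow_succ] using congrArg (eval x) h

open Polynomial in
theorem X_sq_sub_C_sq_dvd {c : ℝ} (hc : c ≠ 0) {w : ℝ[X]} (h1 : w.eval c = 0)
    (h2 : w.eval (-c) = 0) : X ^ 2 - C c ^ 2 ∣ w := by
  have hcop : IsCoprime (X - C c) (X - C (-c)) :=
    isCoprime_X_sub_C_of_isUnit_sub (by
      rw [isUnit_iff_ne_zero]
      intro h
      exact hc (by linarith))
  have := hcop.mul_dvd (dvd_iff_isRoot.mpr h1) (dvd_iff_isRoot.mpr h2)
  convert this using 1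
  rw [C_neg]
  ring

open Polynomial in
/-- Both components of `(p + √(1-x²) q) (x + β √(1-x²))` vanish to the order of `x² - c²`
when `p + √(1-x²) q` vanishes at `c = β s`, `c² + s² = 1`. -/
theorem X_sq_sub_C_sq_dvd_of_parity (n : ℕ) {p q : ℝ[X]} {c s β : ℝ}
    (hcs : c ^ 2 + s ^ 2 = 1) (hβ : β * s = c) (hs : s ≠ 0)
    (hp : p.comp (-X) = (-1) ^ n * p) (hq : q.comp (-X) = -((-1) ^ n * q))
    (h0 : p.eval c + s * q.eval c = 0) :
    X ^ 2 - C c ^ 2 ∣ X * p + C β * (1 - X ^ 2) * q ∧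
      X ^ 2 - C c ^ 2 ∣ C β * p + X * q := by
  have hpe : ∀ x, p.eval (-x) = (-1) ^ n * p.eval x := fun x => by
    simpa using congrArg (eval x) hp
  have hqe : ∀ x, q.eval (-x) = -((-1) ^ n * q.eval x) := fun x => by
    simpa using congrArg (eval x) hq
  have hpc : p.eval c = -(s * q.eval c) := by linarith
  by_cases hc : c = 0
  · subst hc
    have hβ0 : β = 0 := (mul_eq_zero.mp hβ).resolve_right hs
    have hpq : p.eval 0 = 0 ∧ q.eval 0 = 0 := by
      have h1 := hpe 0
      have h2 := hqe 0
      rw [neg_zero] at h1 h2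
      rcases neg_one_pow_eq_or ℝ n with h | h <;> rw [h] at h1 h2
      · have hq0 : q.eval 0 = 0 := by linarith
        exact ⟨by rw [hpc, hq0]; simp, hq0⟩
      · have hp0 : p.eval 0 = 0 := by linarith
        refine ⟨hp0, ?_⟩
        rw [hp0, zero_add] at h0
        exact (mul_eq_zero.mp h0).resolve_left hs
    obtain ⟨hp0, hq0⟩ := hpq
    have e1 : X ∣ p := by rw [X_dvd_iff, coeff_zero_eq_eval_zero, hp0]
    have e2 : X ∣ q := by rw [X_dvd_iff, coeff_zero_eq_eval_zero, hq0]
    constructor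
    · simpa [hβ0, sq] using mul_dvd_mul_left X e1
    · simpa [hβ0, sq] using mul_dvd_mul_left X e2
  · have hs2 : 1 - c ^ 2 = s ^ 2 := by linarith
    constructor <;> apply X_sq_sub_C_sq_dvd hc
    · simp only [eval_add, eval_mul, eval_X, eval_C, eval_sub, eval_one, eval_pow]
      rw [hpc, hs2]
      linear_combination s * q.eval c * hβ
    · simp only [eval_add, eval_mul, eval_X, eval_C, eval_sub, eval_one, eval_pow]
      rw [hpe, hqe, neg_sq, hpc, hs2]
      linear_combination -(-1) ^ n * s * q.eval c * hβ
    · simp only [eval_add, eval_mul, eval_X, eval_C]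
      rw [hpc]
      linear_combination -q.eval c * hβ
    · simp only [eval_add, eval_mul, eval_X, eval_C]
      rw [hpe, hqe, hpc]
      linear_combination -(-1) ^ n * q.eval c * hβ

open Polynomial in
theorem exists_factor_of_parity (n : ℕ) {p q : ℝ[X]} {c s β : ℝ}
    (hcs : c ^ 2 + s ^ 2 = 1) (hβ : β * s = c) (hs : s ≠ 0)
    (hpd : p.degree ≤ (n + 1 : ℕ)) (hqd : q.degree < (n + 1 : ℕ))
    (hp : p.comp (-X) = (-1) ^ (n + 1) * p) (hq : q.comp (-X) = -((-1) ^ (n + 1) * q))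
    (h0 : p.eval c + s * q.eval c = 0) :
    ∃ u v : ℝ[X], u.degree ≤ n ∧ v.degree < n ∧
      u.comp (-X) = (-1) ^ n * u ∧ v.comp (-X) = -((-1) ^ n * v) ∧
      p = X * u - C β * (1 - X ^ 2) * v ∧ q = X * v - C β * u := by
  obtain ⟨⟨u, hu⟩, ⟨v, hv⟩⟩ := X_sq_sub_C_sq_dvd_of_parity (n + 1) hcs hβ hs hp hq h0
  have hD : (X ^ 2 - C c ^ 2 : ℝ[X]).Monic := by
    rw [← C_pow]
    exact monic_X_pow_sub_C _ two_ne_zero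
  have hDdeg : (X ^ 2 - C c ^ 2 : ℝ[X]).natDegree = 2 := by
    rw [← C_pow]
    exact natDegree_X_pow_sub_C
  have hD0 := hD.ne_zero
  have hDc : (X ^ 2 - C c ^ 2 : ℝ[X]).comp (-X) = X ^ 2 - C c ^ 2 := by simp
  have hCcs : (C c ^ 2 + C s ^ 2 : ℝ[X]) = 1 := by
    simp only [← C_pow, ← C_add, hcs, C_1]
  have hCβ : (C β * C s : ℝ[X]) = C c := by rw [← C_mul, hβ]
  have hpn : p.natDegree ≤ n + 1 := natDegree_le_iff_degree_le.mpr hpd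
  have hqn : q.natDegree ≤ n := (natDegree_le_iff_degree_lt_add_one q n).mpr hqd
  have hud : u.natDegree ≤ n := by
    have h1 : (X * p + C β * (1 - X ^ 2) * q).natDegree ≤ n + 2 := by
      refine natDegree_add_le_of_degree_le ?_ ?_
      · refine natDegree_mul_le.trans ?_
        rw [natDegree_X]
        omega
      · have : (C β * (1 - X ^ 2) : ℝ[X]).natDegree ≤ 2 := by compute_degree
        refine natDegree_mul_le.trans ?_
        omega
    rcases eq_or_ne u 0 with rfl | hu0
    · simp
    · rw [hu, hD.natDegree_mul' hu0, hDdeg] at h1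
      omega
  have hvd : v.degree < n := by
    have h1 : (C β * p + X * q).natDegree ≤ n + 1 := by
      refine natDegree_add_le_of_degree_le ?_ ?_
      · exact (natDegree_C_mul_le _ _).trans hpn
      · refine natDegree_mul_le.trans ?_
        rw [natDegree_X]
        omega
    rcases eq_or_ne v 0 with rfl | hv0
    · simp
    · rw [hv, hD.natDegree_mul' hv0, hDdeg] at h1
      rw [degree_eq_natDegree hv0, Nat.cast_lt]
      omega
  have huc : u.comp (-X) = (-1) ^ n * u := by
    have := congrArg (fun w : ℝ[X] => w.comp (-X)) hu
    simp only [mul_comp, hDc, add_comp, X_comp, C_comp, sub_comp, one_comp, pow_comp, hp, hq]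
      at this
    refine mul_left_cancel₀ hD0 ?_
    linear_combination -this + (-1) ^ n * hu
  have hvc : v.comp (-X) = -((-1) ^ n * v) := by
    have := congrArg (fun w : ℝ[X] => w.comp (-X)) hv
    simp only [mul_comp, hDc, add_comp, X_comp, C_comp, hp, hq] at this
    refine mul_left_cancel₀ hD0 ?_
    linear_combination -this - (-1) ^ n * hv
  refine ⟨C (s ^ 2) * u, C (s ^ 2) * v, ?_, ?_, ?_, ?_, ?_, ?_⟩
  · exact natDegree_le_iff_degree_le.mp ((natDegree_C_mul_le _ _).trans hud)
  · rwa [degree_C_mul (pow_ne_zero 2 hs)]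
  · rw [mul_comp, C_comp, huc]
    ring
  · rw [mul_comp, C_comp, hvc]
    ring
  · refine mul_left_cancel₀ hD0 ?_
    rw [C_pow]
    linear_combination X * C s ^ 2 * hu - C β * C s ^ 2 * (1 - X ^ 2) * hv
      + (-X ^ 2 * p) * hCcs + (1 - X ^ 2) * p * (C β * C s + C c) * hCβ
  · refine mul_left_cancel₀ hD0 ?_
    rw [C_pow]
    linear_combination X * C s ^ 2 * hv - C β * C s ^ 2 * hu
      + (-X ^ 2 * q) * hCcs + (1 - X ^ 2) * q * (C β * C s + C c) * hCβ

/-- A zero `cos t` of an element of `Ω_{n+1}` splits off one factor `x - cot t √(1-x²)`. -/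
theorem MemOmega.exists_factor {n : ℕ} {F : ℝ → ℝ} (hF : MemOmega (n + 1) F) {t : ℝ}
    (ht : t ∈ Set.Ioo 0 Real.pi) (h0 : F (Real.cos t) = 0) :
    ∃ G : ℝ → ℝ, MemOmega n G ∧ ∀ x ∈ Set.Icc (-1 : ℝ) 1,
      F x = G x * (x - Real.cos t / Real.sin t * Real.sqrt (1 - x ^ 2)) := by
  obtain ⟨p, q, hpd, hqd, hp, hq, hF⟩ := (memOmega_iff _ _).mp hF
  have hs : 0 < Real.sin t := Real.sin_pos_of_mem_Ioo ht
  rw [hF _ (Real.cos_mem_Icc t), ← Real.sin_eq_sqrt_one_sub_cos_sq ht.1.le ht.2.le] at h0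
  obtain ⟨u, v, hud, hvd, hu, hv, rfl, rfl⟩ := exists_factor_of_parity n
    (Real.cos_sq_add_sin_sq t) (div_mul_cancel₀ (Real.cos t) hs.ne') hs.ne' hpd hqd hp hq h0
  refine ⟨fun x => u.eval x + Real.sqrt (1 - x ^ 2) * v.eval x,
    (memOmega_iff _ _).mpr ⟨u, v, hud, hvd, hu, hv, fun _ _ => rfl⟩, fun x hx => ?_⟩
  have hx2 : Real.sqrt (1 - x ^ 2) ^ 2 = 1 - x ^ 2 :=
    Real.sq_sqrt (by nlinarith [hx.1, hx.2])
  rw [hF x hx]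
  simp only [Polynomial.eval_sub, Polynomial.eval_mul, Polynomial.eval_X,
    Polynomial.eval_C, Polynomial.eval_one, Polynomial.eval_pow]
  linear_combination (Real.cos t / Real.sin t * v.eval x) * hx2

theorem cos_sub_cot_mul_sin_ne_zero {t u : ℝ} (ht : t ∈ Set.Ioo 0 Real.pi)
    (hu : u ∈ Set.Ioo 0 Real.pi) (h : Real.cos u ≠ Real.cos t) :
    Real.cos u - Real.cos t / Real.sin t * Real.sin u ≠ 0 := by
  have hs : 0 < Real.sin t := Real.sin_pos_of_mem_Ioo ht
  intro h0
  field_simp at h0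
  have h1 : Real.sin (t - u) = 0 := by
    rw [Real.sin_sub]
    linarith
  rw [Real.sin_eq_zero_iff_of_lt_of_lt (by linarith [ht.1, hu.2]) (by linarith [ht.2, hu.1])] at h1
  exact h (by rw [sub_eq_zero.mp h1])

theorem stmt13 (n r : ℕ) (hr1 : 1 ≤ r) (hrn : r ≤ n)
    (F : ℝ → ℝ) (hF : MemOmega n F)
    (θ : Fin r → ℝ) (hθ : ∀ j, θ j ∈ Set.Ioo 0 (2 * Real.pi))
    (hdist : Function.Injective fun j => Real.cos (θ j / 2))
    (hzero : ∀ j, F (Real.cos (θ j / 2)) = 0) :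
    ∃ G : ℝ → ℝ, MemOmega (n - r) G ∧
      ∀ x ∈ Set.Icc (-1 : ℝ) 1,
        F x = G x *
          ∏ j, (x - Real.cos (θ j / 2) / Real.sin (θ j / 2) * Real.sqrt (1 - x ^ 2)) := by
  clear hr1
  induction r generalizing n F with
  | zero => exact ⟨F, hF, fun x _ => by simp⟩
  | succ r ih =>
    obtain ⟨n, rfl⟩ : ∃ m, n = m + 1 := ⟨n - 1, by omega⟩
    have hmem : ∀ j, θ j / 2 ∈ Set.Ioo 0 Real.pi := fun j =>
      ⟨by linarith [(hθ j).1], by linarith [(hθ j).2]⟩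
    obtain ⟨G, hG, hFG⟩ := hF.exists_factor (hmem 0) (hzero 0)
    obtain ⟨H, hH, hGH⟩ := ih n (by omega) G hG (fun j => θ j.succ) (fun j => hθ j.succ)
      (hdist.comp (Fin.succ_injective r)) fun j => by
        have h := hzero j.succ
        rw [hFG _ (Real.cos_mem_Icc _),
          ← Real.sin_eq_sqrt_one_sub_cos_sq (hmem j.succ).1.le (hmem j.succ).2.le] at h
        exact (mul_eq_zero.mp h).resolve_right (cos_sub_cot_mul_sin_ne_zero (hmem 0) (hmem j.succ)
          fun he => Fin.succ_ne_zero j (hdist he))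
    refine ⟨H, by rwa [Nat.add_sub_add_right], fun x hx => ?_⟩
    rw [hFG x hx, hGH x hx, Fin.prod_univ_succ]
    ring
end
end

section
/- Let {c_n}_{n≥1} be an arbitrary real sequence and let {d_{n+1}}_{n≥1} be a positive chain sequence, with W_n defined by the recurrence. Then for every n ≥ 0 one has W_n(−1) = (−1)ⁿ W_n(1) and W_n(1) > 0. -/
noncomputable section

/-- At `x = 1` the recurrence loses its square-root term. -/
theorem W_add_two_one (c d : ℕ → ℝ) (n : ℕ) :
    W c d (n + 2) 1 = W c d (n + 1) 1 - d (n + 2) * W c d n 1 := by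
  simp [W]

theorem W_add_two_neg_one (c d : ℕ → ℝ) (n : ℕ) :
    W c d (n + 2) (-1) = -W c d (n + 1) (-1) - d (n + 2) * W c d n (-1) := by
  simp [W]

theorem W_neg_one (c d : ℕ → ℝ) (n : ℕ) : W c d n (-1) = (-1) ^ n * W c d n 1 := by
  induction n using Nat.twoStepInduction with
  | zero => simp [W]
  | one => simp [W]
  | more n ih ih' =>
    rw [W_add_two_neg_one, W_add_two_one, ih, ih']
    ring

/-- Consecutive values at `1` are positive, with ratio bounded below by the parameters. -/
theorem W_one_pos_and_le {d g : ℕ → ℝ} (c : ℕ → ℝ) (hg₁ : 0 ≤ g 1)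
    (hg : ∀ n, 2 ≤ n → 0 < g n) (hg' : ∀ n, 1 ≤ n → g n < 1)
    (hd : ∀ n, 1 ≤ n → d (n + 1) = (1 - g n) * g (n + 1)) (n : ℕ) :
    0 < W c d n 1 ∧ (1 - g (n + 1)) * W c d n 1 ≤ W c d (n + 1) 1 := by
  induction n with
  | zero => simpa [W] using hg₁
  | succ n ih =>
    obtain ⟨hpos, hle⟩ := ih
    refine ⟨(mul_pos (sub_pos.2 (hg' (n + 1) (by omega))) hpos).trans_le hle, ?_⟩
    rw [W_add_two_one, hd (n + 1) (by omega)]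
    linarith [mul_le_mul_of_nonneg_left hle (hg (n + 2) (by omega)).le]

theorem stmt16 (c d : ℕ → ℝ) (hd : IsPositiveChainSeq d) :
    ∀ n : ℕ, W c d n (-1) = (-1 : ℝ) ^ n * W c d n 1 ∧ 0 < W c d n 1 := by
  obtain ⟨g, ⟨hg₁, hg₁'⟩, hg, hgd⟩ := hd
  have hg' : ∀ n, 1 ≤ n → g n < 1 := fun n hn => by
    obtain rfl | h := hn.eq_or_lt
    · exact hg₁'
    · exact (hg n h).2
  exact fun n => ⟨W_neg_one c d n,
    (W_one_pos_and_le c hg₁ (fun k hk => (hg k hk).1) hg' hgd n).1⟩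
end
end
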